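/- Let n ≥ 1 and s ∈ (0,1) with n > 2s, let K > 0, b ≥ 0 and p > 0. Let v ∈ C^{1,1}_{loc}(ℝⁿ) ∩ L_{2s} be nonnegative and bounded on ℝⁿ and satisfy (-Δ)^s v(x) = K v(x)^p + b classically for all x ∈ ℝⁿ. Then v(x) ≥ c ∫_{ℝⁿ} (K v(y)^p + b)/|x−y|^{n−2s} dy for every x ∈ ℝⁿ, where c = c(n,s) > 0 is the Riesz potential normalization constant; consequently b = 0. -/

import Mathlib

open MeasureTheory Metric Set Filter
open scoped Topology NNReal ENNReal RealInnerProductSpace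

noncomputable section

/-- `n`-dimensional Euclidean space `ℝⁿ`. -/
abbrev Euc (n : ℕ) := EuclideanSpace ℝ (Fin n)

/-- The standard normalization constant `C_{n,s}` of the fractional Laplacian,
`C_{n,s} = 4^s Γ(n/2+s) / (π^{n/2} |Γ(-s)|) = s·4^s·Γ(n/2+s) / (π^{n/2} Γ(1-s))`. -/
def fracC (n : ℕ) (s : ℝ) : ℝ :=
  s * 4 ^ s * Real.Gamma ((n : ℝ) / 2 + s) /
    (Real.pi ^ ((n : ℝ) / 2) * Real.Gamma (1 - s))

/-- `(-Δ)^s u (x) = v` in the classical (Cauchy principal value) sense: the truncated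
integrals `C_{n,s} ∫_{|x-y| ≥ ε} (u(x) - u(y))/|x-y|^{n+2s} dy` tend to `v` as `ε → 0⁺`. -/
def HasFracLapAt (n : ℕ) (s : ℝ) (u : Euc n → ℝ) (x : Euc n) (v : ℝ) : Prop :=
  Tendsto (fun ε : ℝ =>
      fracC n s *
        ∫ y in {y : Euc n | ε ≤ dist x y}, (u x - u y) / dist x y ^ ((n : ℝ) + 2 * s))
    (𝓝[>] (0 : ℝ)) (𝓝 v)

/-- The tail space `L_{2s}`: locally integrable functions with
`∫_{ℝⁿ} |u(y)|/(1+|y|^{n+2s}) dy < ∞`. -/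
def MemL2s (n : ℕ) (s : ℝ) (u : Euc n → ℝ) : Prop :=
  LocallyIntegrable u volume ∧
    Integrable (fun y : Euc n => |u y| / (1 + ‖y‖ ^ ((n : ℝ) + 2 * s))) volume

/-- The `L_{2s}` norm `‖u‖_{L_{2s}} = ∫_{ℝⁿ} |u(y)|/(1+|y|^{n+2s}) dy`. -/
def l2sNorm (n : ℕ) (s : ℝ) (u : Euc n → ℝ) : ℝ :=
  ∫ y : Euc n, |u y| / (1 + ‖y‖ ^ ((n : ℝ) + 2 * s))

/-- `u ∈ C^{1,1}_{loc}(Ω)`: near every point of `Ω`, `u` is `C^1` with a Lipschitz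
continuous derivative. -/
def C11LocOn (n : ℕ) (u : Euc n → ℝ) (Ω : Set (Euc n)) : Prop :=
  ∀ x ∈ Ω, ∃ ε > 0, ball x ε ⊆ Ω ∧ ContDiffOn ℝ 1 u (ball x ε) ∧
    ∃ L : ℝ≥0, LipschitzOnWith L (fun y => fderiv ℝ u y) (ball x ε)

/-- The `C^γ(K)` norm (`0 < γ < 1`) of `u` is bounded by `A`: both the sup norm and the
`γ`-Hölder seminorm of `u` on `K` are at most `A`. -/
def HolderBoundOn (n : ℕ) (γ : ℝ) (u : Euc n → ℝ) (K : Set (Euc n)) (A : ℝ) : Prop :=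
  (∀ x ∈ K, |u x| ≤ A) ∧ ∀ x ∈ K, ∀ y ∈ K, |u x - u y| ≤ A * dist x y ^ γ

/-- Two-sided (interior and exterior) tangent ball condition of radius `ρ` at a boundary
point `z` of `Ω`.  A uniform two-sided ball condition is the standard geometric
characterization of a (locally) `C^{1,1}` boundary: the radius `ρ` is controlled by the
local `C^{1,1}` norm of `∂Ω` and vice versa. -/
def TwoSidedBallAt (n : ℕ) (Ω : Set (Euc n)) (ρ : ℝ) (z : Euc n) : Prop :=
  ∃ ν : Euc n, ‖ν‖ = 1 ∧ ball (z + ρ • ν) ρ ⊆ Ω ∧ ball (z - ρ • ν) ρ ⊆ Ωᶜ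

/-- The Riesz potential normalization constant
`c(n,s) = Γ(n/2 - s) / (4^s π^{n/2} Γ(s))`: the constant for which
`(-Δ)^s (c ∫ f(y)|x-y|^{2s-n} dy) = f` for compactly supported bounded `f`. -/
def rieszC (n : ℕ) (s : ℝ) : ℝ :=
  Real.Gamma ((n : ℝ) / 2 - s) / (4 ^ s * Real.pi ^ ((n : ℝ) / 2) * Real.Gamma s)

/-- The Gauss–Weierstrass heat kernel on `ℝⁿ`. -/
def heatKernel (n : ℕ) (t : ℝ) (z : Euc n) : ℝ :=
  (4 * Real.pi * t) ^ (-(n : ℝ) / 2) * Real.exp (-(1 / (4 * t)) * ‖z‖ ^ 2)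

lemma heatKernel_nonneg {n : ℕ} {t : ℝ} (ht : 0 ≤ t) (z : Euc n) : 0 ≤ heatKernel n t z := by
  unfold heatKernel; positivity

@[fun_prop]
lemma Measurable.heatKernel {α : Type*} [MeasurableSpace α] {n : ℕ} {f : α → ℝ} {g : α → Euc n}
    (hf : Measurable f) (hg : Measurable g) : Measurable fun a => heatKernel n (f a) (g a) := by
  unfold _root_.heatKernel; fun_prop

lemma integrable_heatKernel {n : ℕ} {t : ℝ} (ht : 0 < t) : Integrable (heatKernel n t) := by
  have h0 : (0 : ℝ) < 1 / (4 * t) := by positivity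
  refine Integrable.const_mul (Integrable.of_integral_ne_zero ?_) _
  rw [GaussianFourier.integral_rexp_neg_mul_sq_norm h0]
  positivity

lemma integral_heatKernel {n : ℕ} {t : ℝ} (ht : 0 < t) : ∫ z, heatKernel n t z = 1 := by
  have h0 : (0 : ℝ) < 1 / (4 * t) := by positivity
  unfold heatKernel
  rw [integral_const_mul, GaussianFourier.integral_rexp_neg_mul_sq_norm h0]
  have : Real.pi / (1 / (4 * t)) = 4 * Real.pi * t := by field_simp
  rw [this, ← Real.rpow_add (by positivity)]
  simp [neg_div]

lemma heatKernel_neg {n : ℕ} (t : ℝ) (z : Euc n) : heatKernel n t (-z) = heatKernel n t z := by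
  simp [heatKernel]

lemma lintegral_heatKernel {n : ℕ} {t : ℝ} (ht : 0 < t) :
    ∫⁻ z, ENNReal.ofReal (heatKernel n t z) = 1 := by
  rw [← ofReal_integral_eq_lintegral_ofReal (integrable_heatKernel ht)
    (ae_of_all _ fun z => heatKernel_nonneg ht.le z), integral_heatKernel ht, ENNReal.ofReal_one]

lemma heatKernel_mul_heatKernel {n : ℕ} {t τ : ℝ} (ht : 0 < t) (hτ : 0 < τ) (y z : Euc n) :
    heatKernel n τ z * heatKernel n t (y - z) =
      heatKernel n (t + τ) y * heatKernel n (t * τ / (t + τ)) (z - (τ / (t + τ)) • y) := by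
  unfold heatKernel
  have e1 : ((4 * Real.pi * τ) ^ (-(n : ℝ) / 2) * (4 * Real.pi * t) ^ (-(n : ℝ) / 2)) =
      (4 * Real.pi * (t + τ)) ^ (-(n : ℝ) / 2) *
        (4 * Real.pi * (t * τ / (t + τ))) ^ (-(n : ℝ) / 2) := by
    rw [← Real.mul_rpow (by positivity) (by positivity),
      ← Real.mul_rpow (by positivity) (by positivity)]
    congr 1
    field_simp
  have e2 : -(1 / (4 * τ)) * ‖z‖ ^ 2 + -(1 / (4 * t)) * ‖y - z‖ ^ 2 =
      -(1 / (4 * (t + τ))) * ‖y‖ ^ 2 +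
        -(1 / (4 * (t * τ / (t + τ)))) * ‖z - (τ / (t + τ)) • y‖ ^ 2 := by
    rw [@norm_sub_sq_real, @norm_sub_sq_real, norm_smul, inner_smul_right, real_inner_comm,
      mul_pow, Real.norm_eq_abs, sq_abs]
    field_simp
    ring
  calc _ = ((4 * Real.pi * τ) ^ (-(n : ℝ) / 2) * (4 * Real.pi * t) ^ (-(n : ℝ) / 2)) *
        Real.exp (-(1 / (4 * τ)) * ‖z‖ ^ 2 + -(1 / (4 * t)) * ‖y - z‖ ^ 2) := by
          rw [Real.exp_add]; ring
    _ = _ := by rw [e1, e2, Real.exp_add]; ring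

lemma lintegral_heatKernel_conv {n : ℕ} {t τ : ℝ} (ht : 0 < t) (hτ : 0 < τ) (y : Euc n) :
    ∫⁻ z, ENNReal.ofReal (heatKernel n τ z) * ENNReal.ofReal (heatKernel n t (y - z)) =
      ENNReal.ofReal (heatKernel n (t + τ) y) := by
  simp_rw [← ENNReal.ofReal_mul (heatKernel_nonneg hτ.le _), heatKernel_mul_heatKernel ht hτ,
    ENNReal.ofReal_mul (heatKernel_nonneg (add_pos ht hτ).le _)]
  rw [lintegral_const_mul' _ _ ENNReal.ofReal_ne_top,
    lintegral_sub_right_eq_self (fun z => ENNReal.ofReal (heatKernel n (t * τ / (t + τ)) z)),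
    lintegral_heatKernel (by positivity), mul_one]

/-- Superposing heat kernels produces a homogeneous kernel. -/
lemma lintegral_rpow_mul_heatKernel {n : ℕ} {a : ℝ} (ha : 0 < (n : ℝ) / 2 + a) {z : Euc n}
    (hz : z ≠ 0) :
    ∫⁻ t in Ioi (0 : ℝ), ENNReal.ofReal (t ^ (-1 - a)) * ENNReal.ofReal (heatKernel n t z) =
      ENNReal.ofReal (4 ^ a * Real.Gamma ((n : ℝ) / 2 + a) / Real.pi ^ ((n : ℝ) / 2) *
        ‖z‖ ^ (-((n : ℝ) + 2 * a))) := by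
  have hz' : 0 < ‖z‖ := norm_pos_iff.2 hz
  have hr : 0 < ‖z‖ ^ 2 / 4 := by positivity
  set g : ℝ → ℝ := fun t => t ^ (((n : ℝ) / 2 + a) - 1) * Real.exp (-(‖z‖ ^ 2 / 4 * t)) with hg
  have hgi := Real.integral_rpow_mul_exp_neg_mul_Ioi ha hr
  have hgI : IntegrableOn g (Ioi 0) := by
    apply Integrable.of_integral_ne_zero
    rw [hgi]
    have := Real.Gamma_pos_of_pos ha
    positivity
  have hI := (integrableOn_Ioi_comp_rpow_iff g (p := -1) (by norm_num)).2 hgI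
  have hint := integral_comp_rpow_Ioi g (p := -1) (by norm_num)
  have heq : ∀ t ∈ Ioi (0 : ℝ), t ^ (-1 - a) * heatKernel n t z =
      (4 * Real.pi) ^ (-(n : ℝ) / 2) * ((|(-1 : ℝ)| * t ^ ((-1 : ℝ) - 1)) • g (t ^ (-1 : ℝ))) := by
    intro t ht
    have ht : 0 < t := ht
    simp only [hg, heatKernel, abs_neg, abs_one, one_mul, smul_eq_mul]
    rw [Real.mul_rpow (by positivity) ht.le, ← Real.rpow_mul ht.le]
    have : -(1 / (4 * t)) * ‖z‖ ^ 2 = -(‖z‖ ^ 2 / 4 * t ^ (-1 : ℝ)) := by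
      rw [Real.rpow_neg_one]; field_simp
    rw [this]
    have h2 : t ^ (-1 - a) * t ^ (-(n : ℝ) / 2) =
        t ^ ((-1 : ℝ) - 1) * t ^ (-1 * ((n : ℝ) / 2 + a - 1)) := by
      rw [← Real.rpow_add ht, ← Real.rpow_add ht]; congr 1; ring
    linear_combination ((4 * Real.pi) ^ (-(n : ℝ) / 2) * Real.exp (-(‖z‖ ^ 2 / 4 * t ^ (-1 : ℝ)))) * h2
  have hval : (4 * Real.pi) ^ (-(n : ℝ) / 2) *
      ((1 / (‖z‖ ^ 2 / 4)) ^ ((n : ℝ) / 2 + a) * Real.Gamma ((n : ℝ) / 2 + a)) =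
      4 ^ a * Real.Gamma ((n : ℝ) / 2 + a) / Real.pi ^ ((n : ℝ) / 2) *
        ‖z‖ ^ (-((n : ℝ) + 2 * a)) := by
    have e1 : (1 / (‖z‖ ^ 2 / 4)) = 4 * ‖z‖ ^ (-2 : ℝ) := by
      rw [Real.rpow_neg hz'.le, Real.rpow_two]; field_simp
    rw [e1, Real.mul_rpow (x := 4) (y := Real.pi) (by norm_num) (by positivity),
      Real.mul_rpow (x := 4) (y := ‖z‖ ^ (-2 : ℝ)) (by norm_num) (by positivity),
      ← Real.rpow_mul hz'.le]
    have e2 : (-2 : ℝ) * ((n : ℝ) / 2 + a) = -((n : ℝ) + 2 * a) := by ring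
    have e3 : (4 : ℝ) ^ (-(n : ℝ) / 2) * 4 ^ ((n : ℝ) / 2 + a) = 4 ^ a := by
      rw [← Real.rpow_add (by norm_num)]; congr 1; ring
    rw [e2, ← e3, neg_div, Real.rpow_neg (x := Real.pi) (by positivity)]
    ring
  rw [← hval, ← hgi]
  change _ = ENNReal.ofReal (_ * ∫ t in Ioi 0, g t)
  rw [← hint, ← integral_const_mul, ← setIntegral_congr_fun measurableSet_Ioi heq,
    ofReal_integral_eq_lintegral_ofReal]
  · refine setLIntegral_congr_fun measurableSet_Ioi fun t ht => ?_
    rw [ENNReal.ofReal_mul (Real.rpow_nonneg (le_of_lt ht) _)]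
  · exact (integrableOn_congr_fun heq measurableSet_Ioi).2 (hI.const_mul _)
  · refine (ae_restrict_iff' measurableSet_Ioi).2 (ae_of_all _ fun t ht => ?_)
    exact mul_nonneg (Real.rpow_nonneg (le_of_lt ht) _) (heatKernel_nonneg (le_of_lt ht) _)

lemma lintegral_rpow_mul_exp_neg_mul {a r : ℝ} (ha : 0 < a) (hr : 0 < r) :
    ∫⁻ t in Ioi (0 : ℝ), ENNReal.ofReal (t ^ (a - 1) * Real.exp (-(r * t))) =
      ENNReal.ofReal ((1 / r) ^ a * Real.Gamma a) := by
  have hgi := Real.integral_rpow_mul_exp_neg_mul_Ioi ha hr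
  rw [← hgi, ofReal_integral_eq_lintegral_ofReal]
  · apply Integrable.of_integral_ne_zero
    rw [hgi]
    have := Real.Gamma_pos_of_pos ha
    positivity
  · refine (ae_restrict_iff' measurableSet_Ioi).2 (ae_of_all _ fun t ht => ?_)
    exact mul_nonneg (Real.rpow_nonneg (le_of_lt ht) _) (Real.exp_pos _).le

lemma lintegral_rpow_div_one_add {s : ℝ} (hs0 : 0 < s) (hs1 : s < 1) :
    ∫⁻ σ in Ioi (0 : ℝ), ENNReal.ofReal (σ ^ (s - 1) / (1 + σ)) =
      ENNReal.ofReal (Real.Gamma s * Real.Gamma (1 - s)) := by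
  have h1 : ∀ σ ∈ Ioi (0 : ℝ), ENNReal.ofReal (σ ^ (s - 1) / (1 + σ)) =
      ∫⁻ y in Ioi (0 : ℝ), ENNReal.ofReal (σ ^ (s - 1) * Real.exp (-(y * σ)) * Real.exp (-y)) := by
    intro σ hσ
    have hσ : 0 < σ := hσ
    have h := lintegral_rpow_mul_exp_neg_mul (a := 1) (r := 1 + σ) one_pos (by positivity)
    rw [Real.rpow_one, Real.Gamma_one, mul_one] at h
    rw [div_eq_mul_one_div, ENNReal.ofReal_mul (by positivity), ← h,
      ← lintegral_const_mul' _ _ ENNReal.ofReal_ne_top]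
    refine lintegral_congr fun y => ?_
    rw [← ENNReal.ofReal_mul (by positivity), sub_self, Real.rpow_zero, one_mul, mul_assoc,
      ← Real.exp_add]
    congr 3
    ring
  rw [setLIntegral_congr_fun measurableSet_Ioi h1, lintegral_lintegral_swap]
  · have h2 : ∀ y ∈ Ioi (0 : ℝ),
        ∫⁻ σ in Ioi (0 : ℝ), ENNReal.ofReal (σ ^ (s - 1) * Real.exp (-(y * σ)) * Real.exp (-y)) =
        ENNReal.ofReal (Real.Gamma s) *
          ENNReal.ofReal (y ^ ((1 - s) - 1) * Real.exp (-(1 * y))) := by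
      intro y hy
      have hy : 0 < y := hy
      simp_rw [ENNReal.ofReal_mul' (Real.exp_pos (-y)).le]
      rw [lintegral_mul_const' _ _ ENNReal.ofReal_ne_top, lintegral_rpow_mul_exp_neg_mul hs0 hy,
        ← ENNReal.ofReal_mul (by have := Real.Gamma_pos_of_pos hs0; positivity),
        ← ENNReal.ofReal_mul (Real.Gamma_pos_of_pos hs0).le]
      congr 1
      rw [one_div, Real.inv_rpow hy.le, ← Real.rpow_neg hy.le, sub_sub_cancel_left, one_mul]
      ring
    rw [setLIntegral_congr_fun measurableSet_Ioi h2,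
      lintegral_const_mul' _ _ ENNReal.ofReal_ne_top,
      lintegral_rpow_mul_exp_neg_mul (sub_pos.2 hs1) one_pos, ← ENNReal.ofReal_mul
        (Real.Gamma_pos_of_pos hs0).le]
    simp
  · apply Measurable.aemeasurable
    unfold Function.uncurry
    fun_prop

lemma lintegral_rpow_mul_rpow_sub {s δ r : ℝ} (hs0 : 0 < s) (hδ : 0 < δ) (hr : 0 < r) :
    ∫⁻ τ in Ioo 0 r, ENNReal.ofReal ((τ + δ) ^ (-1 - s) * (r - τ) ^ (s - 1)) =
      ENNReal.ofReal (r ^ s * δ ^ (-s) / (s * (r + δ))) := by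
  set F : ℝ → ℝ := fun τ => -(((r - τ) / (τ + δ)) ^ s / (s * (r + δ))) with hF
  have hcont : ContinuousOn F (Icc 0 r) := by
    refine ContinuousOn.neg (ContinuousOn.div_const (ContinuousOn.rpow_const ?_ ?_) _)
    · refine ContinuousOn.div (by fun_prop) (by fun_prop) fun τ hτ => ?_
      have := hτ.1; positivity
    · intro τ _; exact Or.inr hs0.le
  have hderiv : ∀ τ ∈ Ioo 0 r,
      HasDerivAt F ((τ + δ) ^ (-1 - s) * (r - τ) ^ (s - 1)) τ := by
    intro τ hτ
    have h1 : 0 < r - τ := sub_pos.2 hτ.2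
    have h2 : 0 < τ + δ := add_pos hτ.1 hδ
    have hd : HasDerivAt (fun τ : ℝ => (r - τ) / (τ + δ))
        (((-1) * (τ + δ) - (r - τ) * 1) / (τ + δ) ^ 2) τ :=
      ((hasDerivAt_id τ).const_sub r).div ((hasDerivAt_id τ).add_const δ) h2.ne'
    have hd2 := ((hd.rpow_const (p := s) (Or.inl (by positivity))).div_const (s * (r + δ))).neg
    refine hd2.congr_deriv ?_
    rw [Real.div_rpow h1.le h2.le, Real.rpow_sub_one h1.ne', Real.rpow_sub_one h2.ne',
      Real.rpow_sub h2, Real.rpow_neg_one]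
    have := Real.rpow_pos_of_pos h2 s
    field_simp
    ring
  have hnn : ∀ τ ∈ Ioo 0 r, 0 ≤ (τ + δ) ^ (-1 - s) * (r - τ) ^ (s - 1) := fun τ hτ =>
    mul_nonneg (Real.rpow_nonneg (add_pos hτ.1 hδ).le _)
      (Real.rpow_nonneg (sub_pos.2 hτ.2).le _)
  have hint := intervalIntegral.integrableOn_deriv_of_nonneg hcont hderiv hnn
  have hval := intervalIntegral.integral_eq_sub_of_hasDerivAt_of_le hr.le hcont hderiv
    ((intervalIntegrable_iff_integrableOn_Ioc_of_le hr.le).2 hint)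
  rw [intervalIntegral.integral_of_le hr.le, integral_Ioc_eq_integral_Ioo] at hval
  have hval2 : F r - F 0 = r ^ s * δ ^ (-s) / (s * (r + δ)) := by
    simp only [hF, sub_self, zero_div, Real.zero_rpow hs0.ne', sub_zero, zero_add]
    rw [Real.div_rpow hr.le hδ.le, Real.rpow_neg hδ.le]
    ring
  rw [← hval2, ← hval, ofReal_integral_eq_lintegral_ofReal]
  · exact hint.mono_set Ioo_subset_Ioc_self
  · exact (ae_restrict_iff' measurableSet_Ioo).2 (ae_of_all _ hnn)

/-- The total mass of the weight `(τ + δ)^{-1-s}`. -/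
lemma lintegral_add_rpow {s δ : ℝ} (hs0 : 0 < s) (hδ : 0 < δ) :
    ∫⁻ τ in Ioi (0 : ℝ), ENNReal.ofReal ((τ + δ) ^ (-1 - s)) = ENNReal.ofReal (δ ^ (-s) / s) := by
  have hI : IntegrableOn (fun τ : ℝ => (τ + δ) ^ (-1 - s)) (Ioi 0) := by
    simpa using integrableOn_add_rpow_Ioi_of_lt (a := -1 - s) (c := 0) (m := δ) (by linarith)
      (by simpa using hδ)
  have hv : ∫ τ in Ioi (0 : ℝ), (τ + δ) ^ (-1 - s) = δ ^ (-s) / s := by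
    have h := (measurePreserving_add_right volume δ).setIntegral_preimage_emb
      (measurableEmbedding_addRight δ) (fun τ : ℝ => τ ^ (-1 - s)) (Ioi δ)
    rw [preimage_add_const_Ioi, sub_self] at h
    rw [h, integral_Ioi_rpow_of_lt (by linarith) hδ]
    have : -1 - s + 1 = -s := by ring
    rw [this]
    field_simp
  rw [← hv, ofReal_integral_eq_lintegral_ofReal hI]
  refine (ae_restrict_iff' measurableSet_Ioi).2 (ae_of_all _ fun t ht => ?_)
  exact Real.rpow_nonneg (add_pos ht hδ).le _

/-- The heat semigroup applied to a nonnegative function, evaluated at the origin. -/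
def heatMean (n : ℕ) (G : Euc n → ℝ≥0∞) (r : ℝ) : ℝ≥0∞ :=
  ∫⁻ y, ENNReal.ofReal (heatKernel n r y) * G y

lemma measurable_heatMean {n : ℕ} {G : Euc n → ℝ≥0∞} (hG : Measurable G) :
    Measurable (heatMean n G) := by
  unfold heatMean
  exact Measurable.lintegral_prod_right'
    (f := fun q : ℝ × Euc n => ENNReal.ofReal (heatKernel n q.1 q.2) * G q.2) (by fun_prop)

/-- The coefficient `π^{-n/2} 4^a Γ(n/2+a)` of `‖z‖^{-(n+2a)}` in the superposition of heat
kernels with weight `t^{-1-a}`. -/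
def heatCoeff (n : ℕ) (a : ℝ) : ℝ :=
  4 ^ a * Real.Gamma ((n : ℝ) / 2 + a) / Real.pi ^ ((n : ℝ) / 2)

lemma lintegral_riesz_eq {n : ℕ} (hn : 1 ≤ n) {s : ℝ} (hns : 2 * s < n) {G : Euc n → ℝ≥0∞}
    (hG : Measurable G) (z : Euc n) :
    ∫⁻ y, ENNReal.ofReal (heatCoeff n (-s) * ‖y - z‖ ^ (-((n : ℝ) - 2 * s))) * G y =
      ∫⁻ t in Ioi (0 : ℝ), ENNReal.ofReal (t ^ (s - 1)) *
        ∫⁻ y, ENNReal.ofReal (heatKernel n t (y - z)) * G y := by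
  have : Nonempty (Fin n) := ⟨⟨0, hn⟩⟩
  have h1 : ∀ᵐ y : Euc n, ENNReal.ofReal (heatCoeff n (-s) * ‖y - z‖ ^ (-((n : ℝ) - 2 * s))) * G y =
      ∫⁻ t in Ioi (0 : ℝ), ENNReal.ofReal (t ^ (s - 1)) *
        (ENNReal.ofReal (heatKernel n t (y - z)) * G y) := by
    filter_upwards [(measure_eq_zero_iff_ae_notMem (μ := volume)).1 (measure_singleton z)] with y hy
    have h := lintegral_rpow_mul_heatKernel (n := n) (a := -s) (by linarith) (z := y - z)
      (sub_ne_zero.2 hy)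
    have e1 : (n : ℝ) + 2 * -s = n - 2 * s := by ring
    have e2 : -1 - -s = s - 1 := by ring
    rw [e1, e2] at h
    rw [heatCoeff, ← h, ← lintegral_mul_const _ (by fun_prop)]
    simp_rw [mul_assoc]
  rw [lintegral_congr_ae h1, lintegral_lintegral_swap]
  · refine lintegral_congr fun t => ?_
    rw [lintegral_const_mul' _ _ ENNReal.ofReal_ne_top]
  · apply Measurable.aemeasurable
    unfold Function.uncurry
    fun_prop

lemma lintegral_heatKernel_mul_riesz {n : ℕ} (hn : 1 ≤ n) {s : ℝ} (hns : 2 * s < n)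
    {G : Euc n → ℝ≥0∞} (hG : Measurable G) {τ : ℝ} (hτ : 0 < τ) :
    ∫⁻ z, ENNReal.ofReal (heatKernel n τ z) *
        ∫⁻ y, ENNReal.ofReal (heatCoeff n (-s) * ‖y - z‖ ^ (-((n : ℝ) - 2 * s))) * G y =
      ∫⁻ t in Ioi (0 : ℝ), ENNReal.ofReal (t ^ (s - 1)) * heatMean n G (t + τ) := by
  have hm : Measurable fun q : (Euc n × ℝ) × Euc n =>
      ENNReal.ofReal (heatKernel n q.1.2 (q.2 - q.1.1)) * G q.2 := by fun_prop
  have h1 : ∀ z : Euc n, ENNReal.ofReal (heatKernel n τ z) *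
        ∫⁻ y, ENNReal.ofReal (heatCoeff n (-s) * ‖y - z‖ ^ (-((n : ℝ) - 2 * s))) * G y =
      ∫⁻ t in Ioi (0 : ℝ), ENNReal.ofReal (heatKernel n τ z) * (ENNReal.ofReal (t ^ (s - 1)) *
          ∫⁻ y, ENNReal.ofReal (heatKernel n t (y - z)) * G y) := fun z => by
    rw [lintegral_riesz_eq hn hns hG, lintegral_const_mul' _ _ ENNReal.ofReal_ne_top]
  rw [lintegral_congr h1, lintegral_lintegral_swap]
  · refine setLIntegral_congr_fun measurableSet_Ioi fun t ht => ?_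
    have h2 : ∀ z : Euc n, ENNReal.ofReal (heatKernel n τ z) * (ENNReal.ofReal (t ^ (s - 1)) *
          ∫⁻ y, ENNReal.ofReal (heatKernel n t (y - z)) * G y) =
        ENNReal.ofReal (t ^ (s - 1)) * ∫⁻ y, ENNReal.ofReal (heatKernel n τ z) *
          ENNReal.ofReal (heatKernel n t (y - z)) * G y := by
      intro z
      simp_rw [mul_assoc]
      rw [lintegral_const_mul' _ _ ENNReal.ofReal_ne_top]
      ring
    simp only [h2]
    rw [lintegral_const_mul' _ _ ENNReal.ofReal_ne_top, lintegral_lintegral_swap]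
    · congr 1
      refine lintegral_congr fun y => ?_
      rw [lintegral_mul_const _ (by fun_prop), lintegral_heatKernel_conv ht hτ]
    · apply Measurable.aemeasurable
      unfold Function.uncurry
      fun_prop
  · apply Measurable.aemeasurable
    unfold Function.uncurry
    have : Measurable fun q : Euc n × ℝ =>
      ∫⁻ y, ENNReal.ofReal (heatKernel n q.2 (y - q.1)) * G y := hm.lintegral_prod_right'
    fun_prop

/-- A regularization of the kernel `‖z‖^{-(n+2s)}` by superposition of heat kernels. -/
def regKernel (n : ℕ) (s δ : ℝ) (z : Euc n) : ℝ≥0∞ :=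
  ∫⁻ τ in Ioi (0 : ℝ), ENNReal.ofReal ((τ + δ) ^ (-1 - s)) * ENNReal.ofReal (heatKernel n τ z)

lemma measurable_regKernel (n : ℕ) (s δ : ℝ) : Measurable (regKernel n s δ) := by
  unfold regKernel
  exact Measurable.lintegral_prod_right' (f := fun q : Euc n × ℝ =>
    ENNReal.ofReal ((q.2 + δ) ^ (-1 - s)) * ENNReal.ofReal (heatKernel n q.2 q.1)) (by fun_prop)

lemma lintegral_regKernel_mul {n : ℕ} {s δ : ℝ} {H : Euc n → ℝ≥0∞} (hH : Measurable H) :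
    ∫⁻ z, regKernel n s δ z * H z = ∫⁻ τ in Ioi (0 : ℝ), ENNReal.ofReal ((τ + δ) ^ (-1 - s)) *
      ∫⁻ z, ENNReal.ofReal (heatKernel n τ z) * H z := by
  unfold regKernel
  have h1 : ∀ z, (∫⁻ τ in Ioi (0 : ℝ), ENNReal.ofReal ((τ + δ) ^ (-1 - s)) *
      ENNReal.ofReal (heatKernel n τ z)) * H z = ∫⁻ τ in Ioi (0 : ℝ),
        ENNReal.ofReal ((τ + δ) ^ (-1 - s)) * (ENNReal.ofReal (heatKernel n τ z) * H z) := by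
    intro z
    rw [← lintegral_mul_const _ (by fun_prop)]
    simp_rw [mul_assoc]
  simp_rw [h1]
  rw [lintegral_lintegral_swap]
  · simp_rw [lintegral_const_mul' _ _ ENNReal.ofReal_ne_top]
  · apply Measurable.aemeasurable
    unfold Function.uncurry
    fun_prop

lemma lintegral_regKernel {n : ℕ} {s δ : ℝ} (hs0 : 0 < s) (hδ : 0 < δ) :
    ∫⁻ z, regKernel n s δ z = ENNReal.ofReal (δ ^ (-s) / s) := by
  have h := lintegral_regKernel_mul (n := n) (s := s) (δ := δ) (H := fun _ => 1) measurable_const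
  simp only [mul_one] at h
  rw [h, ← lintegral_add_rpow hs0 hδ]
  refine setLIntegral_congr_fun measurableSet_Ioi fun τ hτ => ?_
  simp only [lintegral_heatKernel hτ, mul_one]

lemma lintegral_regKernel_mul_riesz {n : ℕ} (hn : 1 ≤ n) {s δ : ℝ} (hs0 : 0 < s)
    (hns : 2 * s < n) (hδ : 0 < δ) {G : Euc n → ℝ≥0∞} (hG : Measurable G) :
    ∫⁻ z, regKernel n s δ z *
        ∫⁻ y, ENNReal.ofReal (heatCoeff n (-s) * ‖y - z‖ ^ (-((n : ℝ) - 2 * s))) * G y =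
      ∫⁻ r in Ioi (0 : ℝ), ENNReal.ofReal (r ^ s * δ ^ (-s) / (s * (r + δ))) * heatMean n G r := by
  have hu := measurable_heatMean hG
  have hW : Measurable fun z => ∫⁻ y,
      ENNReal.ofReal (heatCoeff n (-s) * ‖y - z‖ ^ (-((n : ℝ) - 2 * s))) * G y :=
    Measurable.lintegral_prod_right' (f := fun q : Euc n × Euc n =>
      ENNReal.ofReal (heatCoeff n (-s) * ‖q.2 - q.1‖ ^ (-((n : ℝ) - 2 * s))) * G q.2) (by fun_prop)
  rw [lintegral_regKernel_mul hW]
  have h1 : ∀ τ ∈ Ioi (0 : ℝ), ENNReal.ofReal ((τ + δ) ^ (-1 - s)) *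
      ∫⁻ z, ENNReal.ofReal (heatKernel n τ z) *
        ∫⁻ y, ENNReal.ofReal (heatCoeff n (-s) * ‖y - z‖ ^ (-((n : ℝ) - 2 * s))) * G y =
      ∫⁻ r in Ioi (0 : ℝ), (Ioi τ).indicator (fun r => ENNReal.ofReal ((τ + δ) ^ (-1 - s)) *
        (ENNReal.ofReal ((r - τ) ^ (s - 1)) * heatMean n G r)) r := by
    intro τ hτ
    have hτ : 0 < τ := hτ
    rw [lintegral_heatKernel_mul_riesz hn hns hG hτ,
      ← lintegral_const_mul' _ _ ENNReal.ofReal_ne_top,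
      lintegral_indicator measurableSet_Ioi, Measure.restrict_restrict measurableSet_Ioi,
      inter_eq_left.2 (Ioi_subset_Ioi hτ.le)]
    have h := (measurePreserving_add_right volume τ).setLIntegral_comp_preimage_emb
      (measurableEmbedding_addRight τ) (fun r => ENNReal.ofReal ((τ + δ) ^ (-1 - s)) *
        (ENNReal.ofReal ((r - τ) ^ (s - 1)) * heatMean n G r)) (Ioi τ)
    rw [preimage_add_const_Ioi, sub_self] at h
    rw [← h]
    simp
  rw [setLIntegral_congr_fun measurableSet_Ioi h1, lintegral_lintegral_swap]
  · refine setLIntegral_congr_fun measurableSet_Ioi fun r hr => ?_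
    have hr : 0 < r := hr
    have h2 : ∀ τ : ℝ, (Ioi τ).indicator (fun r => ENNReal.ofReal ((τ + δ) ^ (-1 - s)) *
        (ENNReal.ofReal ((r - τ) ^ (s - 1)) * heatMean n G r)) r =
        (Iio r).indicator (fun τ => ENNReal.ofReal ((τ + δ) ^ (-1 - s)) *
        (ENNReal.ofReal ((r - τ) ^ (s - 1)) * heatMean n G r)) τ := by
      intro τ
      by_cases h : τ < r <;> simp [indicator, h]
    simp only [h2]
    rw [lintegral_indicator measurableSet_Iio, Measure.restrict_restrict measurableSet_Iio,
      Iio_inter_Ioi, ← lintegral_rpow_mul_rpow_sub hs0 hδ hr, ← lintegral_mul_const _ (by fun_prop)]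
    refine setLIntegral_congr_fun measurableSet_Ioo fun τ hτ => ?_
    rw [ENNReal.ofReal_mul (Real.rpow_nonneg (add_pos hτ.1 hδ).le _), mul_assoc]
  · apply Measurable.aemeasurable
    have hS : MeasurableSet {q : ℝ × ℝ | q.1 < q.2} := measurableSet_lt measurable_fst measurable_snd
    have : Measurable fun q : ℝ × ℝ => ENNReal.ofReal ((q.1 + δ) ^ (-1 - s)) *
        (ENNReal.ofReal ((q.2 - q.1) ^ (s - 1)) * heatMean n G q.2) := by fun_prop
    convert this.indicator hS using 1
    ext ⟨a, b⟩
    simp [Function.uncurry, indicator]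

/-- The defect between the mass of the regularized kernel and its action on a Riesz potential. -/
lemma lintegral_regKernel_riesz_add {n : ℕ} (hn : 1 ≤ n) {s δ : ℝ} (hs0 : 0 < s)
    (hns : 2 * s < n) (hδ : 0 < δ) {G : Euc n → ℝ≥0∞} (hG : Measurable G) :
    (∫⁻ z, regKernel n s δ z *
        ∫⁻ y, ENNReal.ofReal (heatCoeff n (-s) * ‖y - z‖ ^ (-((n : ℝ) - 2 * s))) * G y) +
      ∫⁻ r in Ioi (0 : ℝ), ENNReal.ofReal (r ^ (s - 1) * δ ^ (1 - s) / (s * (r + δ))) *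
        heatMean n G r =
    ENNReal.ofReal (δ ^ (-s) / s) *
      ∫⁻ y, ENNReal.ofReal (heatCoeff n (-s) * ‖y‖ ^ (-((n : ℝ) - 2 * s))) * G y := by
  have hu := measurable_heatMean hG
  have h0 := lintegral_riesz_eq hn hns hG 0
  simp only [sub_zero] at h0
  rw [lintegral_regKernel_mul_riesz hn hs0 hns hδ hG, h0,
    ← lintegral_const_mul' _ _ ENNReal.ofReal_ne_top, ← lintegral_add_left (by fun_prop)]
  refine setLIntegral_congr_fun measurableSet_Ioi fun r hr => ?_
  have hr : 0 < r := hr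
  change _ + _ = _ * (_ * heatMean n G r)
  rw [← add_mul, ← mul_assoc, ← ENNReal.ofReal_add (by positivity) (by positivity),
    ← ENNReal.ofReal_mul (by positivity)]
  congr 2
  rw [Real.rpow_sub_one hr.ne', sub_eq_add_neg 1 s, Real.rpow_add hδ, Real.rpow_one]
  field_simp

lemma regKernel_neg {n : ℕ} {s δ : ℝ} (z : Euc n) : regKernel n s δ (-z) = regKernel n s δ z := by
  simp [regKernel, heatKernel_neg]

lemma lintegral_rpow_mul_heatKernel_pos {n : ℕ} {s : ℝ} (hs0 : 0 < s) {z : Euc n} (hz : z ≠ 0) :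
    ∫⁻ t in Ioi (0 : ℝ), ENNReal.ofReal (t ^ (-1 - s)) * ENNReal.ofReal (heatKernel n t z) =
      ENNReal.ofReal (heatCoeff n s * ‖z‖ ^ (-((n : ℝ) + 2 * s))) :=
  lintegral_rpow_mul_heatKernel (by positivity) hz

lemma ofReal_add_rpow_le {s δ τ : ℝ} (hs0 : 0 < s) (hδ : 0 ≤ δ) (hτ : 0 < τ) :
    ENNReal.ofReal ((τ + δ) ^ (-1 - s)) ≤ ENNReal.ofReal (τ ^ (-1 - s)) :=
  ENNReal.ofReal_le_ofReal
    (Real.rpow_le_rpow_of_nonpos hτ (by linarith) (by linarith))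

lemma regKernel_le {n : ℕ} {s δ : ℝ} (hs0 : 0 < s) (hδ : 0 ≤ δ) {z : Euc n} (hz : z ≠ 0) :
    regKernel n s δ z ≤ ENNReal.ofReal (heatCoeff n s * ‖z‖ ^ (-((n : ℝ) + 2 * s))) := by
  rw [← lintegral_rpow_mul_heatKernel_pos hs0 hz]
  refine setLIntegral_mono' measurableSet_Ioi fun τ hτ => ?_
  gcongr ?_ * _
  exact ofReal_add_rpow_le hs0 hδ hτ

lemma tendsto_regKernel {n : ℕ} {s : ℝ} (hs0 : 0 < s) {z : Euc n} (hz : z ≠ 0) :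
    Tendsto (fun δ => regKernel n s δ z) (𝓝[>] 0)
      (𝓝 (ENNReal.ofReal (heatCoeff n s * ‖z‖ ^ (-((n : ℝ) + 2 * s))))) := by
  rw [← lintegral_rpow_mul_heatKernel_pos hs0 hz]
  refine tendsto_lintegral_filter_of_dominated_convergence (fun τ : ℝ =>
    ENNReal.ofReal (τ ^ (-1 - s)) * ENNReal.ofReal (heatKernel n τ z)) ?_ ?_ ?_ ?_
  · exact Eventually.of_forall fun δ => by fun_prop
  · filter_upwards [self_mem_nhdsWithin] with δ hδ
    refine (ae_restrict_iff' measurableSet_Ioi).2 (ae_of_all _ fun τ hτ => ?_)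
    gcongr ?_ * _
    exact ofReal_add_rpow_le hs0 (le_of_lt hδ) hτ
  · rw [lintegral_rpow_mul_heatKernel_pos hs0 hz]
    exact ENNReal.ofReal_ne_top
  · refine (ae_restrict_iff' measurableSet_Ioi).2 (ae_of_all _ fun τ hτ => ?_)
    refine ENNReal.Tendsto.mul_const (ENNReal.tendsto_ofReal ?_) (Or.inr ENNReal.ofReal_ne_top)
    have hc : ContinuousAt (fun δ : ℝ => (τ + δ) ^ (-1 - s)) 0 :=
      ContinuousAt.rpow_const (by fun_prop) (Or.inl (by simpa using ne_of_gt hτ))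
    have := hc.tendsto.mono_left (nhdsWithin_le_nhds (s := Ioi 0))
    simpa using this

lemma heatCoeff_pos {n : ℕ} {a : ℝ} (ha : 0 < (n : ℝ) / 2 + a) : 0 < heatCoeff n a := by
  have := Real.Gamma_pos_of_pos ha
  unfold heatCoeff; positivity

lemma heatCoeff_eq_fracC {n : ℕ} {s : ℝ} (hs0 : 0 < s) (hs1 : s < 1) :
    heatCoeff n s = fracC n s * (Real.Gamma (1 - s) / s) := by
  have := Real.Gamma_pos_of_pos (sub_pos.2 hs1)
  unfold heatCoeff fracC
  field_simp

lemma heatCoeff_neg_eq_rieszC {n : ℕ} {s : ℝ} (hs0 : 0 < s) :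
    heatCoeff n (-s) = Real.Gamma s * rieszC n s := by
  have := Real.Gamma_pos_of_pos hs0
  unfold heatCoeff rieszC
  rw [Real.rpow_neg (by norm_num), ← sub_eq_add_neg]
  field_simp

lemma heatKernel_smul {n : ℕ} {r : ℝ} (hr : 0 < r) (y : Euc n) :
    heatKernel n r (√r • y) = (√r ^ n)⁻¹ * heatKernel n 1 y := by
  unfold heatKernel
  have h1 : -(1 / (4 * r)) * ‖√r • y‖ ^ 2 = -(1 / (4 * 1)) * ‖y‖ ^ 2 := by
    rw [norm_smul, mul_pow, Real.norm_eq_abs, sq_abs, Real.sq_sqrt hr.le]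
    field_simp
  rw [h1, mul_one, Real.mul_rpow (by positivity) hr.le]
  have h2 : r ^ (-(n : ℝ) / 2) = (√r ^ n)⁻¹ := by
    rw [Real.sqrt_eq_rpow, ← Real.rpow_natCast, ← Real.rpow_mul hr.le, ← Real.rpow_neg hr.le]
    ring_nf
  rw [h2]
  ring_nf

lemma integral_heatKernel_mul {n : ℕ} {r : ℝ} (hr : 0 < r) (h : Euc n → ℝ) :
    ∫ y, heatKernel n r y * h y = ∫ y, heatKernel n 1 y * h (√r • y) := by
  have hpos : 0 < √r ^ n := by positivity
  have := Measure.integral_comp_smul_of_nonneg (volume : Measure (Euc n))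
    (fun y => heatKernel n r y * h y) (√r) (hR := Real.sqrt_nonneg r)
  simp only [heatKernel_smul hr, finrank_euclideanSpace, Fintype.card_fin, mul_assoc,
    integral_const_mul, smul_eq_mul] at this
  exact (mul_left_cancel₀ (inv_pos.2 hpos).ne' this).symm

lemma abs_integral_heatKernel_mul_le {n : ℕ} {h : Euc n → ℝ} {M : ℝ} (hM : ∀ y, |h y| ≤ M)
    {r : ℝ} (hr : 0 < r) : |∫ y, heatKernel n r y * h y| ≤ M := by
  have h1 : ‖∫ y, heatKernel n r y * h y‖ ≤ ∫ y, heatKernel n r y * M := by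
    refine norm_integral_le_of_norm_le ((integrable_heatKernel hr).mul_const M)
      (ae_of_all _ fun y => ?_)
    rw [norm_mul, Real.norm_eq_abs, Real.norm_eq_abs, abs_of_nonneg (heatKernel_nonneg hr.le y)]
    exact mul_le_mul_of_nonneg_left (hM y) (heatKernel_nonneg hr.le y)
  rwa [integral_mul_const, integral_heatKernel hr, one_mul] at h1

lemma tendsto_integral_heatKernel_mul {n : ℕ} {h : Euc n → ℝ} (hc : Continuous h) {M : ℝ}
    (hM : ∀ y, |h y| ≤ M) :
    Tendsto (fun r => ∫ y, heatKernel n r y * h y) (𝓝[>] 0) (𝓝 (h 0)) := by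
  have h1 : Tendsto (fun r : ℝ => ∫ y, heatKernel n 1 y * h (√r • y)) (𝓝[>] 0)
      (𝓝 (∫ y, heatKernel n 1 y * h 0)) := by
    refine tendsto_integral_filter_of_dominated_convergence (fun y => heatKernel n 1 y * M)
      ?_ ?_ ((integrable_heatKernel one_pos).mul_const M) ?_
    · exact Eventually.of_forall fun r => (integrable_heatKernel one_pos).aestronglyMeasurable.mul
        (by fun_prop)
    · refine Eventually.of_forall fun r => ae_of_all _ fun y => ?_
      rw [norm_mul, Real.norm_eq_abs, Real.norm_eq_abs,
        abs_of_nonneg (heatKernel_nonneg zero_le_one y)]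
      exact mul_le_mul_of_nonneg_left (hM _) (heatKernel_nonneg zero_le_one y)
    · refine ae_of_all _ fun y => Tendsto.const_mul _ ?_
      have : Continuous fun r : ℝ => h (√r • y) := by fun_prop
      simpa using (this.tendsto 0).mono_left (nhdsWithin_le_nhds (s := Ioi 0))
  rw [integral_mul_const, integral_heatKernel one_pos, one_mul] at h1
  refine h1.congr' ?_
  filter_upwards [self_mem_nhdsWithin] with r hr
  rw [integral_heatKernel_mul hr]

lemma integrable_min_sq_mul_rpow {n : ℕ} (hn : 1 ≤ n) {s : ℝ} (hs0 : 0 < s) (hs1 : s < 1) :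
    Integrable fun z : Euc n => min 1 (‖z‖ ^ 2) * ‖z‖ ^ (-((n : ℝ) + 2 * s)) := by
  have : Nonempty (Fin n) := ⟨⟨0, hn⟩⟩
  have key : ∀ y : ℝ, 0 < y → y ^ (n - 1) * y ^ (-((n : ℝ) + 2 * s)) = y ^ (-1 - 2 * s) := by
    intro y hy
    rw [← Real.rpow_natCast, ← Real.rpow_add hy, Nat.cast_sub hn]
    congr 1; push_cast; ring
  refine (integrable_fun_norm_addHaar (volume : Measure (Euc n))
    (f := fun r => min 1 (r ^ 2) * r ^ (-((n : ℝ) + 2 * s)))).2 ?_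
  simp only [finrank_euclideanSpace, Fintype.card_fin, smul_eq_mul]
  rw [← Ioc_union_Ioi_eq_Ioi (zero_le_one (α := ℝ)), integrableOn_union]
  constructor
  · have h1 : IntegrableOn (fun y : ℝ => y ^ (1 - 2 * s)) (Ioc 0 1) :=
      (intervalIntegrable_iff_integrableOn_Ioc_of_le zero_le_one).1
        (intervalIntegral.intervalIntegrable_rpow' (by linarith))
    refine h1.congr_fun (fun y hy => ?_) measurableSet_Ioc
    have hle : y ^ 2 ≤ 1 := pow_le_one₀ hy.1.le hy.2
    beta_reduce
    rw [min_eq_right hle, mul_left_comm, key y hy.1, ← Real.rpow_natCast, ← Real.rpow_add hy.1]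
    congr 1; push_cast; ring
  · refine (integrableOn_Ioi_rpow_of_lt (a := -1 - 2 * s) (by linarith) one_pos).congr_fun
      (fun y hy => ?_) measurableSet_Ioi
    have hy0 : (0 : ℝ) < y := one_pos.trans hy
    beta_reduce
    rw [min_eq_left (one_le_pow₀ (le_of_lt hy)), one_mul, key y hy0]

lemma integrableOn_norm_rpow {n : ℕ} (hn : 1 ≤ n) {s : ℝ} (hs0 : 0 < s) (hs1 : s < 1) {ε : ℝ}
    (hε : 0 < ε) :
    IntegrableOn (fun z : Euc n => ‖z‖ ^ (-((n : ℝ) + 2 * s))) {z | ε ≤ ‖z‖} := by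
  have hm : MeasurableSet {z : Euc n | ε ≤ ‖z‖} := measurableSet_le measurable_const measurable_norm
  have hpos : 0 < min 1 (ε ^ 2) := by positivity
  refine Integrable.mono' (((integrable_min_sq_mul_rpow hn hs0 hs1).const_mul
    (min 1 (ε ^ 2))⁻¹).integrableOn (s := {z | ε ≤ ‖z‖}))
    (Measurable.aestronglyMeasurable (by fun_prop)) ?_
  refine (ae_restrict_iff' hm).2 (ae_of_all _ fun z hz => ?_)
  have hz : ε ≤ ‖z‖ := hz
  have h0 : 0 ≤ ‖z‖ ^ (-((n : ℝ) + 2 * s)) := by positivity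
  rw [Real.norm_of_nonneg h0, ← mul_assoc]
  refine le_mul_of_one_le_left h0 ?_
  rw [inv_mul_eq_div, one_le_div hpos]
  gcongr

lemma integrableOn_sub_div_dist_rpow {n : ℕ} (hn : 1 ≤ n) {s : ℝ} (hs0 : 0 < s) (hs1 : s < 1)
    {w : Euc n → ℝ} (hw : Continuous w) {B : ℝ} (hB : ∀ y, |w y| ≤ B) (x : Euc n) {ε : ℝ}
    (hε : 0 < ε) :
    IntegrableOn (fun y => (w x - w y) / dist x y ^ ((n : ℝ) + 2 * s)) {y | ε ≤ dist x y} := by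
  have h1 : IntegrableOn (fun y => ‖x - y‖ ^ (-((n : ℝ) + 2 * s))) {y | ε ≤ dist x y} := by
    have := ((Measure.measurePreserving_sub_left (volume : Measure (Euc n)) x).integrableOn_comp_preimage
      (MeasurableEquiv.subLeft x).measurableEmbedding).2 (integrableOn_norm_rpow hn hs0 hs1 hε)
    simpa [dist_eq_norm, Function.comp_def] using this
  refine Integrable.mono' (h1.const_mul (2 * B)) ?_ (ae_of_all _ fun y => ?_)
  · have := hw.measurable
    exact Measurable.aestronglyMeasurable (by fun_prop)
  · have hb : |w x - w y| ≤ 2 * B := (abs_sub _ _).trans (by linarith [hB x, hB y])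
    rw [Real.norm_eq_abs, abs_div, dist_eq_norm, Real.rpow_neg (norm_nonneg _), ← div_eq_mul_inv,
      abs_of_nonneg (a := ‖x - y‖ ^ _) (by positivity)]
    gcongr

lemma abs_second_diff_le {n : ℕ} {w : Euc n → ℝ} (hw : ContDiff ℝ 2 w) {B : ℝ}
    (hB : ∀ y, |w y| ≤ B) (x : Euc n) :
    ∃ C, ∀ z, |2 * w x - w (x + z) - w (x - z)| ≤ C * min 1 (‖z‖ ^ 2) := by
  have hd : ContDiff ℝ 1 (fderiv ℝ w) := hw.fderiv_right (by norm_num)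
  obtain ⟨K, t, ht, hK⟩ := hd.contDiffAt.exists_lipschitzOnWith (x := x)
  obtain ⟨r', hr', hrt⟩ := Metric.mem_nhds_iff.1 ht
  set r := min r' 1 with hr_def
  have hr : 0 < r := lt_min hr' one_pos
  have hr1 : r ≤ 1 := min_le_right _ _
  have hB0 : 0 ≤ B := (abs_nonneg _).trans (hB x)
  refine ⟨2 * K + 4 * B / r ^ 2, fun z => ?_⟩
  rcases lt_or_ge ‖z‖ r with hz | hz
  · have hsub : closedBall x ‖z‖ ⊆ t := fun y hy =>
      hrt (lt_of_le_of_lt (mem_closedBall.1 hy) (hz.trans_le (min_le_left _ _)))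
    have hT : ∀ u : Euc n, ‖u‖ = ‖z‖ → |w (x + u) - w x - fderiv ℝ w x u| ≤ K * ‖z‖ * ‖z‖ := by
      intro u hu
      have := (convex_closedBall x ‖z‖).norm_image_sub_le_of_norm_hasFDerivWithin_le'
        (f := w) (f' := fderiv ℝ w) (φ := fderiv ℝ w x) (C := K * ‖z‖) (x := x) (y := x + u)
        (fun y _ => ((hw.differentiable (by norm_num)) y).hasFDerivAt.hasFDerivWithinAt)
        (fun y hy => by
          rw [← dist_eq_norm]
          refine (hK.dist_le_mul y (hsub hy) x (hsub (by simp))).trans ?_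
          have := mem_closedBall.1 hy
          gcongr)
        (by simp) (by simp [hu])
      simpa [hu] using this
    have h1 := hT z rfl
    have h2 := hT (-z) (norm_neg z)
    rw [map_neg, ← sub_eq_add_neg] at h2
    have hz2 : min 1 (‖z‖ ^ 2) = ‖z‖ ^ 2 :=
      min_eq_right (pow_le_one₀ (norm_nonneg _) (hz.le.trans hr1))
    have h3 : |2 * w x - w (x + z) - w (x - z)| ≤ K * ‖z‖ * ‖z‖ + K * ‖z‖ * ‖z‖ := by
      have : 2 * w x - w (x + z) - w (x - z) =
        -((w (x + z) - w x - fderiv ℝ w x z) + (w (x - z) - w x - -fderiv ℝ w x z)) := by ring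
      rw [this, abs_neg]
      exact (abs_add_le _ _).trans (add_le_add h1 h2)
    have h4 : 0 ≤ 4 * B / r ^ 2 * ‖z‖ ^ 2 := by positivity
    rw [hz2]; nlinarith
  · have h1 : |2 * w x - w (x + z) - w (x - z)| ≤ 4 * B := by
      have h1 := abs_le.1 (hB x)
      have h2 := abs_le.1 (hB (x + z))
      have h3 := abs_le.1 (hB (x - z))
      exact abs_le.2 ⟨by linarith, by linarith⟩
    have h2 : r ^ 2 ≤ min 1 (‖z‖ ^ 2) :=
      le_min (pow_le_one₀ hr.le hr1) (by gcongr)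
    have h3 : 4 * B = 4 * B / r ^ 2 * r ^ 2 := by field_simp
    have h4 : 4 * B / r ^ 2 * r ^ 2 ≤ 4 * B / r ^ 2 * min 1 (‖z‖ ^ 2) := by gcongr
    have h5 : 0 ≤ 2 * (K : ℝ) * min 1 (‖z‖ ^ 2) := by positivity
    nlinarith

lemma integrable_second_diff {n : ℕ} (hn : 1 ≤ n) {s : ℝ} (hs0 : 0 < s) (hs1 : s < 1)
    {w : Euc n → ℝ} (hw : Continuous w) {x : Euc n} {C : ℝ}
    (hC : ∀ z, |2 * w x - w (x + z) - w (x - z)| ≤ C * min 1 (‖z‖ ^ 2)) :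
    Integrable fun z => ‖z‖ ^ (-((n : ℝ) + 2 * s)) * (2 * w x - w (x + z) - w (x - z)) := by
  refine Integrable.mono' ((integrable_min_sq_mul_rpow hn hs0 hs1).const_mul C) ?_
    (ae_of_all _ fun z => ?_)
  · have := hw.measurable
    exact Measurable.aestronglyMeasurable (by fun_prop)
  · have h0 : 0 ≤ ‖z‖ ^ (-((n : ℝ) + 2 * s)) := by positivity
    rw [norm_mul, Real.norm_of_nonneg h0, Real.norm_eq_abs, mul_comm, ← mul_assoc]
    gcongr
    exact hC z

lemma setIntegral_sub_div_dist {n : ℕ} (hn : 1 ≤ n) {s : ℝ} (hs0 : 0 < s) (hs1 : s < 1)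
    {w : Euc n → ℝ} (hw : Continuous w) {B : ℝ} (hB : ∀ y, |w y| ≤ B) (x : Euc n) {ε : ℝ}
    (hε : 0 < ε) :
    ∫ y in {y | ε ≤ dist x y}, (w x - w y) / dist x y ^ ((n : ℝ) + 2 * s) =
      1 / 2 * ∫ z in {z : Euc n | ε ≤ ‖z‖},
        ‖z‖ ^ (-((n : ℝ) + 2 * s)) * (2 * w x - w (x + z) - w (x - z)) := by
  set F : Euc n → ℝ := fun y => (w x - w y) / dist x y ^ ((n : ℝ) + 2 * s)
  have hF := integrableOn_sub_div_dist_rpow hn hs0 hs1 hw hB x hε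
  have mpS := Measure.measurePreserving_sub_left (volume : Measure (Euc n)) x
  have mpA := measurePreserving_add_left (volume : Measure (Euc n)) x
  have eS : MeasurableEmbedding fun z : Euc n => x - z :=
    (MeasurableEquiv.subLeft x).measurableEmbedding
  have eA : MeasurableEmbedding fun z : Euc n => x + z := measurableEmbedding_addLeft x
  have pS : (fun z => x - z) ⁻¹' {y | ε ≤ dist x y} = {z : Euc n | ε ≤ ‖z‖} := by
    ext z; simp [dist_eq_norm]
  have pA : (fun z => x + z) ⁻¹' {y | ε ≤ dist x y} = {z : Euc n | ε ≤ ‖z‖} := by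
    ext z; simp [dist_eq_norm]
  have iS := mpS.setIntegral_preimage_emb eS F {y | ε ≤ dist x y}
  have iA := mpA.setIntegral_preimage_emb eA F {y | ε ≤ dist x y}
  have jS : IntegrableOn (fun z => F (x - z)) _ := (mpS.integrableOn_comp_preimage eS).2 hF
  have jA : IntegrableOn (fun z => F (x + z)) _ := (mpA.integrableOn_comp_preimage eA).2 hF
  rw [pS] at iS jS
  rw [pA] at iA jA
  have hsum : ∫ z in {z : Euc n | ε ≤ ‖z‖},
      ‖z‖ ^ (-((n : ℝ) + 2 * s)) * (2 * w x - w (x + z) - w (x - z)) =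
      (∫ z in {z : Euc n | ε ≤ ‖z‖}, F (x + z)) + ∫ z in {z : Euc n | ε ≤ ‖z‖}, F (x - z) := by
    rw [← integral_add jA jS]
    refine integral_congr_ae (ae_of_all _ fun z => ?_)
    simp only [F, dist_eq_norm, sub_add_cancel_left, norm_neg, sub_sub_cancel,
      Real.rpow_neg (norm_nonneg _)]
    ring
  rw [hsum, iA, iS]; ring

lemma hasFracLapAt_of_second_diff {n : ℕ} (hn : 1 ≤ n) {s : ℝ} (hs0 : 0 < s) (hs1 : s < 1)
    {w : Euc n → ℝ} (hw : Continuous w) {B : ℝ} (hB : ∀ y, |w y| ≤ B) {x : Euc n} {C : ℝ}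
    (hC : ∀ z, |2 * w x - w (x + z) - w (x - z)| ≤ C * min 1 (‖z‖ ^ 2)) :
    HasFracLapAt n s w x (fracC n s * (1 / 2 *
      ∫ z, ‖z‖ ^ (-((n : ℝ) + 2 * s)) * (2 * w x - w (x + z) - w (x - z)))) := by
  have : Nonempty (Fin n) := ⟨⟨0, hn⟩⟩
  set F : Euc n → ℝ := fun z => ‖z‖ ^ (-((n : ℝ) + 2 * s)) * (2 * w x - w (x + z) - w (x - z))
  have hF : Integrable F := integrable_second_diff hn hs0 hs1 hw hC
  have hlim : Tendsto (fun ε : ℝ => ∫ z, {z : Euc n | ε ≤ ‖z‖}.indicator F z) (𝓝[>] 0)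
      (𝓝 (∫ z, F z)) := by
    refine tendsto_integral_filter_of_dominated_convergence (fun z => ‖F z‖) ?_ ?_ hF.norm ?_
    · exact Eventually.of_forall fun ε => hF.aestronglyMeasurable.indicator
        (measurableSet_le measurable_const measurable_norm)
    · exact Eventually.of_forall fun ε => ae_of_all _ fun z => norm_indicator_le_norm_self _ _
    · filter_upwards [Measure.ae_ne volume (0 : Euc n)] with z hz
      refine tendsto_const_nhds.congr' ?_
      filter_upwards [Ioo_mem_nhdsGT (norm_pos_iff.2 hz)] with ε hε
      exact (indicator_of_mem (s := {z : Euc n | ε ≤ ‖z‖}) hε.2.le F).symm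
  refine ((hlim.const_mul (1 / 2)).const_mul (fracC n s)).congr' ?_
  filter_upwards [self_mem_nhdsWithin] with ε hε
  rw [setIntegral_sub_div_dist hn hs0 hs1 hw hB x hε,
    integral_indicator (measurableSet_le measurable_const measurable_norm)]

/-- The Riesz potential of `g`, the convolution of `c(n,s) ‖y‖^{2s-n}` with `g`. -/
def rieszPot (n : ℕ) (s : ℝ) (g : Euc n → ℝ) (x : Euc n) : ℝ :=
  ∫ y, rieszC n s * ‖y‖ ^ (-((n : ℝ) - 2 * s)) * g (x - y)

lemma rieszC_pos {n : ℕ} {s : ℝ} (hs0 : 0 < s) (hns : 2 * s < n) : 0 < rieszC n s := by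
  have h1 := Real.Gamma_pos_of_pos hs0
  have h2 : 0 < Real.Gamma ((n : ℝ) / 2 - s) := Real.Gamma_pos_of_pos (by linarith)
  unfold rieszC; positivity

lemma fracC_pos (n : ℕ) {s : ℝ} (hs0 : 0 < s) (hs1 : s < 1) : 0 < fracC n s := by
  have h1 := Real.Gamma_pos_of_pos (sub_pos.2 hs1)
  have h2 : 0 < Real.Gamma ((n : ℝ) / 2 + s) := Real.Gamma_pos_of_pos (by positivity)
  unfold fracC; positivity

lemma locallyIntegrable_riesz {n : ℕ} (hn : 1 ≤ n) {s : ℝ} (hs0 : 0 < s) (c : ℝ) :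
    LocallyIntegrable fun y : Euc n => c * ‖y‖ ^ (-((n : ℝ) - 2 * s)) := by
  refine locallyIntegrable_of_norm_le_rpow (C := |c|) (α := (n : ℝ) - 2 * s) (by simpa using hn)
    (by simpa using hs0) (ae_of_all _ fun y => ?_) (Measurable.aestronglyMeasurable (by fun_prop))
  rw [norm_mul, Real.norm_eq_abs, Real.norm_of_nonneg (by positivity)]

section
variable {n : ℕ} {s : ℝ} {g : Euc n → ℝ}

lemma integrable_riesz_mul (hn : 1 ≤ n) (hs0 : 0 < s) (hg : Continuous g)
    (hgc : HasCompactSupport g) (x : Euc n) :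
    Integrable fun y => rieszC n s * ‖y‖ ^ (-((n : ℝ) - 2 * s)) * g (x - y) :=
  hgc.convolutionExists_right (ContinuousLinearMap.mul ℝ ℝ) (locallyIntegrable_riesz hn hs0 _) hg x

lemma contDiff_rieszPot (hn : 1 ≤ n) (hs0 : 0 < s) (hg : ContDiff ℝ 2 g)
    (hgc : HasCompactSupport g) : ContDiff ℝ 2 (rieszPot n s g) :=
  hgc.contDiff_convolution_right (n := 2) (ContinuousLinearMap.mul ℝ ℝ)
    (locallyIntegrable_riesz (n := n) hn hs0 (rieszC n s)) hg

lemma rieszPot_nonneg (hs0 : 0 < s) (hns : 2 * s < n) (hg0 : ∀ y, 0 ≤ g y) (x : Euc n) :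
    0 ≤ rieszPot n s g x :=
  integral_nonneg fun y => by
    have := rieszC_pos hs0 hns
    have := hg0 (x - y)
    positivity

lemma ofReal_rieszPot (hn : 1 ≤ n) (hs0 : 0 < s) (hns : 2 * s < n) (hg : Continuous g)
    (hgc : HasCompactSupport g) (hg0 : ∀ y, 0 ≤ g y) (x : Euc n) :
    ENNReal.ofReal (rieszPot n s g x) =
      ∫⁻ y, ENNReal.ofReal (rieszC n s * ‖y‖ ^ (-((n : ℝ) - 2 * s)) * g (x - y)) :=
  ofReal_integral_eq_lintegral_ofReal (integrable_riesz_mul hn hs0 hg hgc x)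
    (ae_of_all _ fun y => by
      have := rieszC_pos hs0 hns
      have := hg0 (x - y)
      show 0 ≤ _
      positivity)

lemma rieszPot_eq_integral_sub (x : Euc n) :
    rieszPot n s g x = ∫ y, rieszC n s * ‖x - y‖ ^ (-((n : ℝ) - 2 * s)) * g y := by
  rw [← integral_sub_left_eq_self _ volume x]
  simp [rieszPot]

lemma tendsto_rieszPot_cocompact (hs0 : 0 < s) (hns : 2 * s < n) (hg : Continuous g)
    (hgc : HasCompactSupport g) (hg0 : ∀ y, 0 ≤ g y) :
    Tendsto (rieszPot n s g) (cocompact (Euc n)) (𝓝 0) := by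
  have hc := rieszC_pos hs0 hns
  obtain ⟨R, hR⟩ := hgc.isCompact.isBounded.subset_closedBall (0 : Euc n)
  have hgR : ∀ y, g y ≠ 0 → ‖y‖ ≤ R := fun y hy =>
    mem_closedBall_zero_iff.1 (hR (subset_tsupport _ hy))
  have hgi : Integrable g := hg.integrable_of_hasCompactSupport hgc
  have hlim : Tendsto (fun x : Euc n =>
      rieszC n s * (‖x‖ - R) ^ (-((n : ℝ) - 2 * s)) * ∫ y, g y) (cocompact (Euc n)) (𝓝 0) := by
    have h1 : Tendsto (fun x : Euc n => ‖x‖ - R) (cocompact (Euc n)) atTop :=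
      tendsto_atTop_add_const_right _ (-R) tendsto_norm_cocompact_atTop
    have h2 := (tendsto_rpow_neg_atTop (sub_pos.2 hns)).comp h1
    simpa using (h2.const_mul (rieszC n s)).mul_const (∫ y, g y)
  refine squeeze_zero' (Eventually.of_forall (rieszPot_nonneg hs0 hns hg0)) ?_ hlim
  filter_upwards [(tendsto_norm_cocompact_atTop (E := Euc n)).eventually_gt_atTop R] with x hx
  rw [rieszPot_eq_integral_sub, ← integral_const_mul]
  refine integral_mono_of_nonneg (ae_of_all _ fun y => ?_) (hgi.const_mul _)
    (ae_of_all _ fun y => ?_)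
  · have := hg0 y
    show 0 ≤ _
    positivity
  · by_cases hy : g y = 0
    · simp [hy]
    · have h1 : ‖x‖ - R ≤ ‖x - y‖ := by linarith [hgR y hy, norm_sub_norm_le x y]
      have := hg0 y
      beta_reduce
      gcongr ?_ * ?_ * _
      · exact Real.rpow_le_rpow_of_nonpos (by linarith) h1 (by linarith)

lemma exists_bound_rieszPot (hn : 1 ≤ n) (hs0 : 0 < s) (hns : 2 * s < n) (hg : ContDiff ℝ 2 g)
    (hgc : HasCompactSupport g) (hg0 : ∀ y, 0 ≤ g y) :
    ∃ B, ∀ x, |rieszPot n s g x| ≤ B := by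
  have h0 := rieszPot_nonneg hs0 hns hg0
  have hc : Continuous fun x => -rieszPot n s g x := (contDiff_rieszPot hn hs0 hg hgc).continuous.neg
  have hl := tendsto_rieszPot_cocompact hs0 hns hg.continuous hgc hg0
  obtain ⟨K, hK, hKs⟩ := mem_cocompact.1 (hl.eventually (ge_mem_nhds one_pos))
  obtain ⟨C, hC⟩ := hK.exists_bound_of_continuousOn hc.continuousOn
  refine ⟨max C 1, fun x => ?_⟩
  by_cases hx : x ∈ K
  · exact le_max_of_le_left (by simpa using hC x hx)
  · rw [abs_of_nonneg (h0 x)]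
    exact le_max_of_le_right (hKs hx)

end

lemma tendsto_integral_rpow_mul {s : ℝ} (hs0 : 0 < s) (hs1 : s < 1) {U : ℝ → ℝ} {M L : ℝ}
    (hU : Measurable U) (hM : ∀ r, 0 < r → |U r| ≤ M) (hL : Tendsto U (𝓝[>] 0) (𝓝 L)) :
    Tendsto (fun δ : ℝ => ∫ r in Ioi (0 : ℝ), r ^ (s - 1) * δ ^ (1 - s) / (s * (r + δ)) * U r)
      (𝓝[>] 0) (𝓝 (Real.Gamma s * Real.Gamma (1 - s) / s * L)) := by
  have hG1 := Real.Gamma_pos_of_pos hs0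
  have hG2 := Real.Gamma_pos_of_pos (sub_pos.2 hs1)
  set k : ℝ → ℝ := fun σ => σ ^ (s - 1) / (1 + σ)
  have hk0 : ∀ σ ∈ Ioi (0 : ℝ), 0 ≤ k σ := fun σ hσ => by
    have : (0 : ℝ) < σ := hσ
    simp only [k]; positivity
  have hkm : Measurable k := by fun_prop
  have hk0' : 0 ≤ᵐ[volume.restrict (Ioi 0)] k :=
    (ae_restrict_iff' measurableSet_Ioi).2 (ae_of_all _ hk0)
  have hki : IntegrableOn k (Ioi 0) := by
    refine ⟨hkm.aestronglyMeasurable, ?_⟩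
    rw [hasFiniteIntegral_iff_ofReal hk0', lintegral_rpow_div_one_add hs0 hs1]
    exact ENNReal.ofReal_lt_top
  have hkint : ∫ σ in Ioi 0, k σ = Real.Gamma s * Real.Gamma (1 - s) := by
    rw [integral_eq_lintegral_of_nonneg_ae hk0' hkm.aestronglyMeasurable,
      lintegral_rpow_div_one_add hs0 hs1, ENNReal.toReal_ofReal (by positivity)]
  have h1 : Tendsto (fun δ : ℝ => ∫ σ in Ioi (0 : ℝ), k σ / s * U (δ * σ)) (𝓝[>] 0)
      (𝓝 (∫ σ in Ioi (0 : ℝ), k σ / s * L)) := by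
    refine tendsto_integral_filter_of_dominated_convergence (fun σ => k σ / s * M) ?_ ?_
      ((hki.div_const s).mul_const M) ?_
    · exact Eventually.of_forall fun δ => Measurable.aestronglyMeasurable (by fun_prop)
    · filter_upwards [self_mem_nhdsWithin] with δ hδ
      refine (ae_restrict_iff' measurableSet_Ioi).2 (ae_of_all _ fun σ hσ => ?_)
      have h2 : 0 ≤ k σ / s := div_nonneg (hk0 σ hσ) hs0.le
      rw [norm_mul, Real.norm_of_nonneg h2]
      exact mul_le_mul_of_nonneg_left (hM _ (mul_pos hδ hσ)) h2
    · refine (ae_restrict_iff' measurableSet_Ioi).2 (ae_of_all _ fun σ hσ => ?_)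
      refine Tendsto.const_mul _ (hL.comp ?_)
      refine tendsto_nhdsWithin_iff.2 ⟨?_, ?_⟩
      · have : Continuous fun δ : ℝ => δ * σ := by fun_prop
        simpa using (this.tendsto 0).mono_left (nhdsWithin_le_nhds (s := Ioi 0))
      · filter_upwards [self_mem_nhdsWithin] with δ hδ
        exact mul_pos (mem_Ioi.1 hδ) (mem_Ioi.1 hσ)
  rw [integral_mul_const, integral_div, hkint] at h1
  refine h1.congr' ?_
  filter_upwards [self_mem_nhdsWithin] with δ hδ
  have hδ : 0 < δ := hδ
  have h2 := integral_comp_mul_left_Ioi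
    (fun r => r ^ (s - 1) * δ ^ (1 - s) / (s * (r + δ)) * U r) 0 hδ
  rw [mul_zero, smul_eq_mul] at h2
  rw [← mul_right_inj' (inv_ne_zero hδ.ne'), ← h2, ← integral_const_mul]
  refine setIntegral_congr_fun measurableSet_Ioi fun σ hσ => ?_
  have hσ : 0 < σ := hσ
  have h3 : δ ^ (s - 1) * δ ^ (1 - s) = 1 := by
    rw [← Real.rpow_add hδ]; simp
  simp only [k]
  rw [Real.mul_rpow hδ.le hσ.le, mul_right_comm (δ ^ (s - 1)), h3, one_mul]
  field_simp
  ring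

lemma regKernel_lt_top {n : ℕ} {s δ : ℝ} (hs0 : 0 < s) (hδ : 0 ≤ δ) {z : Euc n} (hz : z ≠ 0) :
    regKernel n s δ z < ⊤ :=
  (regKernel_le hs0 hδ hz).trans_lt ENNReal.ofReal_lt_top

section
variable {n : ℕ} {s : ℝ} {g : Euc n → ℝ}

lemma integrable_regKernel_toReal {δ : ℝ} (hs0 : 0 < s) (hδ : 0 < δ) :
    Integrable fun z => (regKernel n s δ z).toReal :=
  integrable_toReal_of_lintegral_ne_top (measurable_regKernel n s δ).aemeasurable
    (by rw [lintegral_regKernel hs0 hδ]; exact ENNReal.ofReal_ne_top)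

lemma ae_regKernel_lt_top (hn : 1 ≤ n) {δ : ℝ} (hs0 : 0 < s) (hδ : 0 < δ) :
    ∀ᵐ z : Euc n, regKernel n s δ z < ⊤ := by
  have : Nonempty (Fin n) := ⟨⟨0, hn⟩⟩
  filter_upwards [Measure.ae_ne volume (0 : Euc n)] with z hz
  exact regKernel_lt_top hs0 hδ.le hz

lemma integral_regKernel_toReal (hn : 1 ≤ n) {δ : ℝ} (hs0 : 0 < s) (hδ : 0 < δ) :
    ∫ z : Euc n, (regKernel n s δ z).toReal = δ ^ (-s) / s := by
  rw [integral_toReal (measurable_regKernel n s δ).aemeasurable (ae_regKernel_lt_top hn hs0 hδ),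
    lintegral_regKernel hs0 hδ, ENNReal.toReal_ofReal (by positivity)]

lemma lintegral_heatCoeff_riesz (hn : 1 ≤ n) (hs0 : 0 < s) (hns : 2 * s < n) (hg : Continuous g)
    (hgc : HasCompactSupport g) (hg0 : ∀ y, 0 ≤ g y) (x z : Euc n) :
    ∫⁻ y, ENNReal.ofReal (heatCoeff n (-s) * ‖y - z‖ ^ (-((n : ℝ) - 2 * s))) *
      ENNReal.ofReal (g (x - y)) = ENNReal.ofReal (Real.Gamma s * rieszPot n s g (x - z)) := by
  have hG := Real.Gamma_pos_of_pos hs0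
  rw [ENNReal.ofReal_mul hG.le, ofReal_rieszPot hn hs0 hns hg hgc hg0,
    ← lintegral_const_mul' _ _ ENNReal.ofReal_ne_top, ← lintegral_add_right_eq_self _ z]
  refine lintegral_congr fun y => ?_
  have := rieszC_pos hs0 hns
  have h1 : x - (y + z) = x - z - y := by abel
  rw [heatCoeff_neg_eq_rieszC hs0, h1, add_sub_cancel_right, ← ENNReal.ofReal_mul (by positivity),
    ← ENNReal.ofReal_mul hG.le]
  congr 1; ring

lemma heatMean_ofReal {r : ℝ} (hr : 0 < r) (hg : Continuous g) (hgc : HasCompactSupport g)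
    (hg0 : ∀ y, 0 ≤ g y) (x : Euc n) :
    heatMean n (fun y => ENNReal.ofReal (g (x - y))) r =
      ENNReal.ofReal (∫ y, heatKernel n r y * g (x - y)) := by
  obtain ⟨M, hM⟩ := hg.bounded_above_of_compact_support hgc
  rw [ofReal_integral_eq_lintegral_ofReal, heatMean]
  · exact lintegral_congr fun y => (ENNReal.ofReal_mul (heatKernel_nonneg hr.le y)).symm
  · exact (integrable_heatKernel hr).mul_bdd (c := M) (by fun_prop) (ae_of_all _ fun y => hM _)
  · exact ae_of_all _ fun y => mul_nonneg (heatKernel_nonneg hr.le y) (hg0 _)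

lemma integral_regKernel_mul_sub (hn : 1 ≤ n) (hs0 : 0 < s) (hns : 2 * s < n)
    (hg : ContDiff ℝ 2 g) (hgc : HasCompactSupport g) (hg0 : ∀ y, 0 ≤ g y) (x : Euc n) {δ : ℝ}
    (hδ : 0 < δ) :
    Real.Gamma s * ∫ z, (regKernel n s δ z).toReal *
        (rieszPot n s g x - rieszPot n s g (x - z)) =
      ∫ r in Ioi (0 : ℝ), r ^ (s - 1) * δ ^ (1 - s) / (s * (r + δ)) *
        (heatMean n (fun y => ENNReal.ofReal (g (x - y))) r).toReal := by
  have hG := Real.Gamma_pos_of_pos hs0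
  have hgm := hg.continuous
  have hw := (contDiff_rieszPot hn hs0 hg hgc).continuous
  have hw0 := rieszPot_nonneg hs0 hns hg0
  obtain ⟨B, hB⟩ := exists_bound_rieszPot hn hs0 hns hg hgc hg0
  have hGm : Measurable fun y => ENNReal.ofReal (g (x - y)) := by
    have := hgm.measurable
    fun_prop
  have key := lintegral_regKernel_riesz_add hn hs0 hns hδ hGm
  have h0 := lintegral_heatCoeff_riesz hn hs0 hns hgm hgc hg0 x 0
  simp only [sub_zero] at h0
  simp only [lintegral_heatCoeff_riesz hn hs0 hns hgm hgc hg0 x, h0] at key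
  have hR : ENNReal.ofReal (δ ^ (-s) / s) * ENNReal.ofReal (Real.Gamma s * rieszPot n s g x) ≠ ⊤ :=
    ENNReal.mul_ne_top ENNReal.ofReal_ne_top ENNReal.ofReal_ne_top
  have hA : ∫⁻ z, regKernel n s δ z * ENNReal.ofReal (Real.Gamma s * rieszPot n s g (x - z)) ≠ ⊤ :=
    fun h => hR (by rw [← key, h, top_add])
  have hBt : ∫⁻ r in Ioi (0 : ℝ), ENNReal.ofReal (r ^ (s - 1) * δ ^ (1 - s) / (s * (r + δ))) *
      heatMean n (fun y => ENNReal.ofReal (g (x - y))) r ≠ ⊤ :=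
    fun h => hR (by rw [← key, h, add_top])
  have key' := congrArg ENNReal.toReal key
  rw [ENNReal.toReal_add hA hBt, ENNReal.toReal_mul, ENNReal.toReal_ofReal (by positivity),
    ENNReal.toReal_ofReal (mul_nonneg hG.le (hw0 x))] at key'
  have eA : (∫⁻ z, regKernel n s δ z *
      ENNReal.ofReal (Real.Gamma s * rieszPot n s g (x - z))).toReal =
      ∫ z, (regKernel n s δ z).toReal * (Real.Gamma s * rieszPot n s g (x - z)) := by
    rw [← integral_toReal]
    · refine integral_congr_ae (ae_of_all _ fun z => ?_)
      simp only [ENNReal.toReal_mul, ENNReal.toReal_ofReal (mul_nonneg hG.le (hw0 (x - z)))]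
    · have := hw.measurable
      exact ((measurable_regKernel n s δ).mul (by fun_prop)).aemeasurable
    · filter_upwards [ae_regKernel_lt_top hn hs0 hδ] with z hz
      exact ENNReal.mul_lt_top hz ENNReal.ofReal_lt_top
  have eB : (∫⁻ r in Ioi (0 : ℝ), ENNReal.ofReal (r ^ (s - 1) * δ ^ (1 - s) / (s * (r + δ))) *
      heatMean n (fun y => ENNReal.ofReal (g (x - y))) r).toReal =
      ∫ r in Ioi (0 : ℝ), r ^ (s - 1) * δ ^ (1 - s) / (s * (r + δ)) *
        (heatMean n (fun y => ENNReal.ofReal (g (x - y))) r).toReal := by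
    rw [← integral_toReal]
    · refine setIntegral_congr_fun measurableSet_Ioi fun r hr => ?_
      have hr : 0 < r := hr
      simp only [ENNReal.toReal_mul]
      rw [ENNReal.toReal_ofReal (by positivity)]
    · have := measurable_heatMean hGm
      exact Measurable.aemeasurable (by fun_prop)
    · refine (ae_restrict_iff' measurableSet_Ioi).2 (ae_of_all _ fun r hr => ?_)
      rw [heatMean_ofReal hr hgm hgc hg0]
      exact ENNReal.mul_lt_top ENNReal.ofReal_lt_top ENNReal.ofReal_lt_top
  rw [eA, eB] at key'
  have hi := integrable_regKernel_toReal (n := n) hs0 hδ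
  have i2 : Integrable fun z => (regKernel n s δ z).toReal * rieszPot n s g (x - z) :=
    hi.mul_bdd (c := B) (by fun_prop) (ae_of_all _ fun z => hB _)
  simp_rw [mul_sub]
  rw [integral_sub (hi.mul_const _) i2, integral_mul_const, integral_regKernel_toReal hn hs0 hδ]
  simp_rw [mul_left_comm _ (Real.Gamma s), integral_const_mul] at key'
  linarith

lemma tendsto_integral_regKernel_mul_second_diff (hn : 1 ≤ n) (hs0 : 0 < s) (hs1 : s < 1)
    {w : Euc n → ℝ} (hw : Continuous w) {x : Euc n} {C : ℝ}
    (hC : ∀ z, |2 * w x - w (x + z) - w (x - z)| ≤ C * min 1 (‖z‖ ^ 2)) :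
    Tendsto (fun δ => ∫ z, (regKernel n s δ z).toReal * (2 * w x - w (x + z) - w (x - z)))
      (𝓝[>] 0) (𝓝 (heatCoeff n s *
        ∫ z, ‖z‖ ^ (-((n : ℝ) + 2 * s)) * (2 * w x - w (x + z) - w (x - z)))) := by
  have : Nonempty (Fin n) := ⟨⟨0, hn⟩⟩
  have hc : 0 < heatCoeff n s := heatCoeff_pos (by positivity)
  rw [← integral_const_mul]
  refine tendsto_integral_filter_of_dominated_convergence (fun z => heatCoeff n s *
    ‖‖z‖ ^ (-((n : ℝ) + 2 * s)) * (2 * w x - w (x + z) - w (x - z))‖) ?_ ?_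
    ((integrable_second_diff hn hs0 hs1 hw hC).norm.const_mul _) ?_
  · refine Eventually.of_forall fun δ => ?_
    have := hw.measurable
    exact ((measurable_regKernel n s δ).ennreal_toReal.mul (by fun_prop)).aestronglyMeasurable
  · filter_upwards [self_mem_nhdsWithin] with δ hδ
    filter_upwards [Measure.ae_ne volume (0 : Euc n)] with z hz
    have h0 : 0 ≤ ‖z‖ ^ (-((n : ℝ) + 2 * s)) := by positivity
    rw [norm_mul, norm_mul, Real.norm_of_nonneg h0, ← mul_assoc,
      Real.norm_of_nonneg ENNReal.toReal_nonneg]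
    gcongr
    exact ENNReal.toReal_le_of_le_ofReal (by positivity) (regKernel_le hs0 (le_of_lt hδ) hz)
  · filter_upwards [Measure.ae_ne volume (0 : Euc n)] with z hz
    have h1 := (ENNReal.tendsto_toReal ENNReal.ofReal_ne_top).comp (tendsto_regKernel hs0 hz)
    rw [ENNReal.toReal_ofReal (by positivity)] at h1
    rw [← mul_assoc]
    exact h1.mul_const _

lemma integral_regKernel_mul_second_diff (hs0 : 0 < s)
    {w : Euc n → ℝ} (hw : Continuous w) {B : ℝ} (hB : ∀ y, |w y| ≤ B) (x : Euc n) {δ : ℝ}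
    (hδ : 0 < δ) :
    ∫ z, (regKernel n s δ z).toReal * (2 * w x - w (x + z) - w (x - z)) =
      2 * ∫ z, (regKernel n s δ z).toReal * (w x - w (x - z)) := by
  set F : Euc n → ℝ := fun z => (regKernel n s δ z).toReal * (w x - w (x - z))
  have hF : Integrable F := (integrable_regKernel_toReal hs0 hδ).mul_bdd (c := 2 * B) (by fun_prop)
    (ae_of_all _ fun z => (abs_sub _ _).trans (by linarith [hB x, hB (x - z)]))
  have h1 : ∫ z, (regKernel n s δ z).toReal * (2 * w x - w (x + z) - w (x - z)) =
      (∫ z, F (-z)) + ∫ z, F z := by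
    rw [← integral_add hF.comp_neg hF]
    refine integral_congr_ae (ae_of_all _ fun z => ?_)
    simp only [F, regKernel_neg, sub_neg_eq_add]
    ring
  rw [h1, integral_neg_eq_self]; ring

theorem hasFracLapAt_rieszPot (hn : 1 ≤ n) (hs0 : 0 < s) (hs1 : s < 1) (hns : 2 * s < n)
    (hg : ContDiff ℝ 2 g) (hgc : HasCompactSupport g) (hg0 : ∀ y, 0 ≤ g y) (x : Euc n) :
    HasFracLapAt n s (rieszPot n s g) x (g x) := by
  have hG := Real.Gamma_pos_of_pos hs0
  have hG' := Real.Gamma_pos_of_pos (sub_pos.2 hs1)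
  have hw2 := contDiff_rieszPot hn hs0 hg hgc
  have hw := hw2.continuous
  have hgm := hg.continuous
  obtain ⟨B, hB⟩ := exists_bound_rieszPot hn hs0 hns hg hgc hg0
  obtain ⟨C, hC⟩ := abs_second_diff_le hw2 hB x
  obtain ⟨M, hM⟩ := hgm.bounded_above_of_compact_support hgc
  have hGm : Measurable fun y => ENNReal.ofReal (g (x - y)) := by
    have := hgm.measurable
    fun_prop
  have hU : ∀ r, 0 < r → (heatMean n (fun y => ENNReal.ofReal (g (x - y))) r).toReal =
      ∫ y, heatKernel n r y * g (x - y) := fun r hr => by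
    rw [heatMean_ofReal hr hgm hgc hg0, ENNReal.toReal_ofReal]
    exact integral_nonneg fun y => mul_nonneg (heatKernel_nonneg hr.le y) (hg0 _)
  have hgx : Continuous fun y => g (x - y) := by fun_prop
  have lim1 := tendsto_integral_rpow_mul (M := M) (L := g x) hs0 hs1
    (measurable_heatMean hGm).ennreal_toReal
    (fun r hr => by
      rw [hU r hr]
      exact abs_integral_heatKernel_mul_le (fun y => hM _) hr)
    (by
      have h1 := tendsto_integral_heatKernel_mul hgx (fun y => hM (x - y))
      rw [sub_zero] at h1
      refine h1.congr' ?_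
      filter_upwards [self_mem_nhdsWithin] with r hr
      rw [hU r hr])
  have lim2 := (tendsto_integral_regKernel_mul_second_diff hn hs0 hs1 hw hC).const_mul
    (Real.Gamma s / 2)
  have heq := tendsto_nhds_unique (lim1.congr' (by
    filter_upwards [self_mem_nhdsWithin] with δ hδ
    rw [← integral_regKernel_mul_sub hn hs0 hns hg hgc hg0 x hδ])) (lim2.congr' (by
    filter_upwards [self_mem_nhdsWithin] with δ hδ
    rw [integral_regKernel_mul_second_diff hs0 hw hB x hδ, ← mul_assoc,
      div_mul_cancel₀ _ two_ne_zero]))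
  rw [heatCoeff_eq_fracC hs0 hs1] at heq
  convert hasFracLapAt_of_second_diff hn hs0 hs1 hw hB hC using 1
  set I := ∫ z, ‖z‖ ^ (-((n : ℝ) + 2 * s)) *
    (2 * rieszPot n s g x - rieszPot n s g (x + z) - rieszPot n s g (x - z))
  field_simp at heq
  linarith

end

lemma neBot_cocompact {n : ℕ} (hn : 1 ≤ n) : (cocompact (Euc n)).NeBot := by
  have : Nonempty (Fin n) := ⟨⟨0, hn⟩⟩
  have := NormedSpace.noncompactSpace ℝ (Euc n)
  infer_instance

lemma HasFracLapAt.sub {n : ℕ} (hn : 1 ≤ n) {s : ℝ} (hs0 : 0 < s) (hs1 : s < 1)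
    {u w : Euc n → ℝ} (hu : Continuous u) (hw : Continuous w) {B B' : ℝ} (hB : ∀ y, |u y| ≤ B)
    (hB' : ∀ y, |w y| ≤ B') {x : Euc n} {a b : ℝ} (ha : HasFracLapAt n s u x a)
    (hb : HasFracLapAt n s w x b) : HasFracLapAt n s (fun y => u y - w y) x (a - b) := by
  refine (Tendsto.sub ha hb).congr' ?_
  filter_upwards [self_mem_nhdsWithin] with ε hε
  rw [← mul_sub, ← integral_sub (integrableOn_sub_div_dist_rpow hn hs0 hs1 hu hB x hε)
    (integrableOn_sub_div_dist_rpow hn hs0 hs1 hw hB' x hε)]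
  congr 2 with y
  ring

lemma HasFracLapAt.neg_of_forall_le {n : ℕ} (hn : 1 ≤ n) {s : ℝ} (hs0 : 0 < s) (hs1 : s < 1)
    {u : Euc n → ℝ} (hu : Continuous u) {B : ℝ} (hB : ∀ y, |u y| ≤ B) {x : Euc n}
    (hmin : ∀ y, u x ≤ u y) (hlt : ∃ y, u x < u y) {a : ℝ} (ha : HasFracLapAt n s u x a) :
    a < 0 := by
  obtain ⟨y₁, hy₁⟩ := hlt
  have hd : 0 < dist x y₁ := dist_pos.2 fun h => by simp [h] at hy₁
  set F : Euc n → ℝ := fun y => (u y - u x) / dist x y ^ ((n : ℝ) + 2 * s)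
  have hF0 : ∀ y, 0 ≤ F y := fun y => div_nonneg (sub_nonneg.2 (hmin y)) (by positivity)
  have hneg : ∀ y, (u x - u y) / dist x y ^ ((n : ℝ) + 2 * s) = -F y := fun y => by
    simp only [F]; ring
  have hFi : ∀ ε, 0 < ε → IntegrableOn F {y | ε ≤ dist x y} := fun ε hε => by
    have := (integrableOn_sub_div_dist_rpow hn hs0 hs1 hu hB x hε).neg
    simp only [hneg] at this
    simpa using this
  set r := dist x y₁ / 2
  have hr : 0 < r := by positivity
  have hJ : 0 < ∫ y in {y | r ≤ dist x y}, F y := by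
    refine (setIntegral_pos_iff_support_of_nonneg_ae (ae_of_all _ hF0) (hFi r hr)).2 ?_
    have ho : IsOpen {y | u x < u y ∧ r < dist x y} :=
      (isOpen_lt continuous_const hu).inter (isOpen_lt continuous_const (continuous_const.dist continuous_id))
    refine (ho.measure_pos volume ⟨y₁, hy₁, half_lt_self hd⟩).trans_le (measure_mono ?_)
    rintro y ⟨h1, h2⟩
    refine ⟨?_, h2.le⟩
    have h3 : 0 < dist x y := hr.trans h2
    have h4 : 0 < u y - u x := sub_pos.2 h1
    exact (div_pos h4 (by positivity)).ne'
  have hc := fracC_pos n hs0 hs1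
  refine lt_of_le_of_lt (le_of_tendsto ha ?_) (neg_neg_of_pos (mul_pos hc hJ))
  filter_upwards [Ioo_mem_nhdsGT hr] with ε hε
  simp only [hneg, integral_neg]
  rw [← mul_neg]
  refine mul_le_mul_of_nonneg_left (neg_le_neg ?_) hc.le
  exact setIntegral_mono_set (hFi ε hε.1) (ae_of_all _ hF0)
    (Eventually.of_forall fun y (hy : r ≤ dist x y) => hε.2.le.trans hy)

lemma rieszPot_le_of_hasFracLapAt {n : ℕ} (hn : 1 ≤ n) {s : ℝ} (hs0 : 0 < s) (hs1 : s < 1)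
    (hns : 2 * s < n) {v f g : Euc n → ℝ} (hv : Continuous v) (hv0 : ∀ x, 0 ≤ v x) {B : ℝ}
    (hB : ∀ x, v x ≤ B) (hvf : ∀ x, HasFracLapAt n s v x (f x)) (hg : ContDiff ℝ 2 g)
    (hgc : HasCompactSupport g) (hg0 : ∀ y, 0 ≤ g y) (hgf : ∀ y, g y ≤ f y) (x : Euc n) :
    rieszPot n s g x ≤ v x := by
  have hw := (contDiff_rieszPot hn hs0 hg hgc).continuous
  obtain ⟨B', hB'⟩ := exists_bound_rieszPot hn hs0 hns hg hgc hg0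
  have hBv : ∀ y, |v y| ≤ B := fun y => (abs_of_nonneg (hv0 y)).trans_le (hB y)
  set φ : Euc n → ℝ := fun y => v y - rieszPot n s g y
  have hφ : Continuous φ := hv.sub hw
  by_contra! hx
  have hinf : ∀ z, φ z < 0 → ∀ᶠ y in cocompact (Euc n), φ z < φ y := fun z hz => by
    filter_upwards [(tendsto_rieszPot_cocompact hs0 hns hg.continuous hgc hg0).eventually_lt_const
      (neg_pos.2 hz)] with y hy
    simp only [φ] at hy ⊢
    linarith [hv0 y]
  have hx' : φ x < 0 := sub_neg.2 hx
  obtain ⟨x₀, hx₀⟩ := hφ.exists_forall_le' x ((hinf x hx').mono fun y => le_of_lt)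
  have := neBot_cocompact hn
  have h1 := HasFracLapAt.neg_of_forall_le hn hs0 hs1 hφ
    (fun y => (abs_sub _ _).trans (add_le_add (hBv y) (hB' y))) hx₀
    (hinf x₀ ((hx₀ x).trans_lt hx')).exists
    (HasFracLapAt.sub hn hs0 hs1 hv hw hBv hB' (hvf x₀)
      (hasFracLapAt_rieszPot hn hs0 hs1 hns hg hgc hg0 x₀))
  linarith [hgf x₀]

lemma exists_contDiff_tendsto {n : ℕ} {f : Euc n → ℝ} (hf : Continuous f) (hf0 : ∀ x, 0 < f x) :
    ∃ g : ℕ → Euc n → ℝ, (∀ k, ContDiff ℝ 2 (g k)) ∧ (∀ k, HasCompactSupport (g k)) ∧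
      (∀ k y, 0 ≤ g k y) ∧ (∀ k y, g k y ≤ f y) ∧
      ∀ y, Tendsto (fun k => g k y) atTop (𝓝 (f y)) := by
  have happ : ∀ k : ℕ, ∃ h : Euc n → ℝ, ContDiff ℝ 2 h ∧
      ∀ x, |h x - (1 - 1 / (k + 2)) * f x| < 1 / (k + 2) * f x := fun k => by
    obtain ⟨h, hh, hd, -⟩ := Continuous.exists_contDiff_approx (f := fun x =>
      (1 - 1 / ((k : ℝ) + 2)) * f x) (ε := fun x => 1 / ((k : ℝ) + 2) * f x) 2 (by fun_prop)
      (by fun_prop) fun x => mul_pos (by positivity) (hf0 x)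
    exact ⟨h, hh, hd⟩
  choose h hh hd using happ
  have hupper : ∀ k x, h k x ≤ f x := fun k x => by
    have := (abs_lt.1 (hd k x)).2
    linarith
  have hlower : ∀ (k : ℕ) x, (1 - 2 * (1 / ((k : ℝ) + 2))) * f x ≤ h k x := fun k x => by
    have := (abs_lt.1 (hd k x)).1
    linarith
  have hnonneg : ∀ k x, 0 ≤ h k x := fun k x => by
    refine le_trans (mul_nonneg ?_ (hf0 x).le) (hlower k x)
    have : 2 * (1 / ((k : ℝ) + 2)) ≤ 1 := by
      rw [mul_one_div, div_le_one (by positivity)]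
      linarith [k.cast_nonneg (α := ℝ)]
    linarith
  let χ : ∀ k : ℕ, ContDiffBump (0 : Euc n) := fun k =>
    ⟨k + 1, k + 2, by positivity, by linarith⟩
  refine ⟨fun k y => χ k y * h k y, fun k => (χ k).contDiff.mul (hh k),
    fun k => (χ k).hasCompactSupport.mul_right, fun k y => mul_nonneg (χ k).nonneg (hnonneg k y),
    fun k y => (mul_le_of_le_one_left (hnonneg k y) (χ k).le_one).trans (hupper k y), fun y => ?_⟩
  have hh' : Tendsto (fun k => h k y) atTop (𝓝 (f y)) := by
    have h1 : Tendsto (fun k : ℕ => 1 / ((k : ℝ) + 2)) atTop (𝓝 0) := by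
      have := (tendsto_const_div_atTop_nhds_zero_nat (1 : ℝ)).comp (tendsto_add_atTop_nat 2)
      refine this.congr fun k => ?_
      simp
    have h2 : Tendsto (fun k : ℕ => (1 - 2 * (1 / ((k : ℝ) + 2))) * f y) atTop (𝓝 (f y)) := by
      simpa using ((h1.const_mul 2).const_sub 1).mul_const (f y)
    exact tendsto_of_tendsto_of_tendsto_of_le_of_le h2 tendsto_const_nhds
      (fun k => hlower k y) (fun k => hupper k y)
  refine hh'.congr' ?_
  filter_upwards [eventually_ge_atTop ⌈‖y‖⌉₊] with k hk
  rw [(χ k).one_of_mem_closedBall, one_mul]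
  have : ‖y‖ ≤ k := Nat.ceil_le.1 hk
  simp only [χ, mem_closedBall_zero_iff]
  linarith

lemma riesz_lintegral_le_of_pos {n : ℕ} (hn : 1 ≤ n) {s : ℝ} (hs0 : 0 < s) (hs1 : s < 1)
    (hns : 2 * s < n) {v f : Euc n → ℝ} (hv : Continuous v) (hv0 : ∀ x, 0 ≤ v x) {B : ℝ}
    (hB : ∀ x, v x ≤ B) (hvf : ∀ x, HasFracLapAt n s v x (f x)) (hf : Continuous f)
    (hf0 : ∀ x, 0 < f x) (x : Euc n) :
    ENNReal.ofReal (rieszC n s) *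
      ∫⁻ y, ENNReal.ofReal (f y / dist x y ^ ((n : ℝ) - 2 * s)) ≤ ENNReal.ofReal (v x) := by
  have hc := rieszC_pos hs0 hns
  obtain ⟨g, hg, hgc, hg0, hgf, hlim⟩ := exists_contDiff_tendsto hf hf0
  set u : ℕ → Euc n → ℝ≥0∞ := fun k y =>
    ENNReal.ofReal (rieszC n s * ‖x - y‖ ^ (-((n : ℝ) - 2 * s)) * g k y)
  have hu : ∀ k, ∫⁻ y, u k y ≤ ENNReal.ofReal (v x) := fun k => by
    have h1 : ∫⁻ y, u k y = ENNReal.ofReal (rieszPot n s (g k) x) := by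
      rw [ofReal_rieszPot hn hs0 hns (hg k).continuous (hgc k) (hg0 k),
        ← lintegral_sub_left_eq_self _ x]
      simp [u]
    rw [h1]
    exact ENNReal.ofReal_le_ofReal (rieszPot_le_of_hasFracLapAt hn hs0 hs1 hns hv hv0 hB hvf
      (hg k) (hgc k) (hg0 k) (hgf k) x)
  have hum : ∀ k, Measurable (u k) := fun k => by
    have := (hg k).continuous.measurable
    fun_prop
  rw [← lintegral_const_mul' _ _ ENNReal.ofReal_ne_top]
  calc _ = ∫⁻ y, liminf (fun k => u k y) atTop := by
        refine lintegral_congr fun y => ?_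
        have h1 : Tendsto (fun k => u k y) atTop (𝓝 (ENNReal.ofReal
          (rieszC n s * ‖x - y‖ ^ (-((n : ℝ) - 2 * s)) * f y))) :=
          ENNReal.tendsto_ofReal ((hlim y).const_mul _)
        rw [h1.liminf_eq, ← ENNReal.ofReal_mul hc.le, dist_eq_norm, Real.rpow_neg (norm_nonneg _)]
        congr 1; ring
    _ ≤ liminf (fun k => ∫⁻ y, u k y) atTop := lintegral_liminf_le hum
    _ ≤ ENNReal.ofReal (v x) :=
        liminf_le_of_frequently_le' (Eventually.of_forall hu).frequently

lemma lintegral_div_norm_rpow_eq_top {n : ℕ} (hn : 1 ≤ n) {s : ℝ} {b : ℝ}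
    (hb : 0 < b) :
    ∫⁻ y : Euc n, ENNReal.ofReal (b / dist 0 y ^ ((n : ℝ) - 2 * s)) = ⊤ := by
  have : Nonempty (Fin n) := ⟨⟨0, hn⟩⟩
  by_contra h
  have hi : Integrable fun y : Euc n => b / ‖y‖ ^ ((n : ℝ) - 2 * s) := by
    refine ⟨Measurable.aestronglyMeasurable (by fun_prop), ?_⟩
    rw [hasFiniteIntegral_iff_ofReal (ae_of_all _ fun y => by show 0 ≤ _; positivity)]
    simpa [lt_top_iff_ne_top] using h
  have h2 := (integrable_fun_norm_addHaar (volume : Measure (Euc n))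
    (f := fun r => b / r ^ ((n : ℝ) - 2 * s))).1 hi
  simp only [finrank_euclideanSpace, Fintype.card_fin, smul_eq_mul] at h2
  refine not_integrableOn_Ioi_rpow (2 * s - 1) (IntegrableOn.congr_fun (h2.const_mul b⁻¹)
    (fun y hy => ?_) measurableSet_Ioi)
  have hy : 0 < y := hy
  have h3 : y ^ (2 * s - 1) = y ^ (n - 1) / y ^ ((n : ℝ) - 2 * s) := by
    rw [← Real.rpow_natCast, ← Real.rpow_sub hy, Nat.cast_sub hn]
    congr 1; push_cast; ring
  rw [h3]
  field_simp

lemma C11LocOn.continuous {n : ℕ} {u : Euc n → ℝ} (hu : C11LocOn n u univ) : Continuous u :=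
  continuous_iff_continuousAt.2 fun x => by
    obtain ⟨ε, hε, -, hd, -⟩ := hu x (mem_univ x)
    exact hd.continuousOn.continuousAt (ball_mem_nhds x hε)
/-- Riesz-potential lower bound and vanishing of `b`, whole space: if
`v ∈ C^{1,1}_{loc}(ℝⁿ) ∩ L_{2s}` is nonnegative, bounded, and solves
`(-Δ)^s v = K v^p + b` classically in `ℝⁿ` with `K > 0`, `b ≥ 0`, `p > 0`, then
`v(x) ≥ c(n,s) ∫_{ℝⁿ} (K v(y)^p + b)/|x-y|^{n-2s} dy` for all `x` (as an inequality of
extended reals, so in particular the integral is finite), and consequently `b = 0`. -/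
theorem riesz_lower_bound_and_b_eq_zero
    (n : ℕ) (hn : 1 ≤ n) (s : ℝ) (hs0 : 0 < s) (hs1 : s < 1) (hns : 2 * s < (n : ℝ))
    (K b p : ℝ) (hK : 0 < K) (hb : 0 ≤ b) (hp : 0 < p)
    (v : Euc n → ℝ) (hv0 : ∀ x, 0 ≤ v x) (hvbdd : ∃ B : ℝ, ∀ x, v x ≤ B)
    (hreg : C11LocOn n v univ) (hL : MemL2s n s v)
    (hsol : ∀ x : Euc n, HasFracLapAt n s v x (K * v x ^ p + b)) :
    (∀ x : Euc n,
      ENNReal.ofReal (rieszC n s) *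
        ∫⁻ y : Euc n, ENNReal.ofReal ((K * v y ^ p + b) / dist x y ^ ((n : ℝ) - 2 * s)) ≤
      ENNReal.ofReal (v x)) ∧ b = 0 := by
  obtain ⟨B, hB⟩ := hvbdd
  have hv : Continuous v := hreg.continuous
  have hBv : ∀ y, |v y| ≤ B := fun y => (abs_of_nonneg (hv0 y)).trans_le (hB y)
  by_cases hzero : ∃ x₀, v x₀ = 0
  · obtain ⟨x₀, hx₀⟩ := hzero
    have hval : K * v x₀ ^ p + b = b := by rw [hx₀, Real.zero_rpow hp.ne']; ring
    have hsol₀ := hsol x₀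
    rw [hval] at hsol₀
    have hv_zero : ∀ y, v y = 0 := by
      by_contra! hne
      obtain ⟨y, hy⟩ := hne
      exact hb.not_gt (HasFracLapAt.neg_of_forall_le hn hs0 hs1 hv hBv
        (fun y => hx₀.trans_le (hv0 y)) ⟨y, hx₀.trans_lt ((hv0 y).lt_of_ne' hy)⟩ hsol₀)
    have hb0 : b = 0 := by
      have h1 : HasFracLapAt n s v x₀ 0 := by simp [HasFracLapAt, hv_zero]
      exact tendsto_nhds_unique hsol₀ h1
    refine ⟨fun x => ?_, hb0⟩
    simp [hv_zero, hb0, Real.zero_rpow hp.ne']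
  · push Not at hzero
    have hvpos : ∀ x, 0 < v x := fun x => (hv0 x).lt_of_ne' (hzero x)
    have hf0 : ∀ x, 0 < K * v x ^ p + b := fun x =>
      add_pos_of_pos_of_nonneg (mul_pos hK (Real.rpow_pos_of_pos (hvpos x) p)) hb
    have hf : Continuous fun x => K * v x ^ p + b :=
      (continuous_const.mul (hv.rpow_const fun x => Or.inl (hzero x))).add continuous_const
    have hmain := riesz_lintegral_le_of_pos hn hs0 hs1 hns hv hv0 hB hsol hf hf0
    refine ⟨hmain, ?_⟩
    by_contra hb0
    have hbpos : 0 < b := hb.lt_of_ne' hb0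
    have htop : ∫⁻ y : Euc n,
        ENNReal.ofReal ((K * v y ^ p + b) / dist 0 y ^ ((n : ℝ) - 2 * s)) = ⊤ := by
      refine top_unique ((lintegral_div_norm_rpow_eq_top (s := s) hn hbpos).symm.le.trans
        (lintegral_mono fun y => ENNReal.ofReal_le_ofReal ?_))
      have := mul_nonneg hK.le (Real.rpow_nonneg (hv0 y) p)
      gcongr
      linarith
    have h0 := hmain 0
    rw [htop, ENNReal.mul_top (ENNReal.ofReal_pos.2 (rieszC_pos hs0 hns)).ne', top_le_iff] at h0
    exact ENNReal.ofReal_ne_top h0
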